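/- Let 0 < a < 1/2, 0 < γ < γ*(a), and c > c*(a). Then there exist ε₀ > 0 and C ≥ 1 such that for every ε ∈ (0, ε₀) there exist L_ε > 0 and a nonconstant continuously differentiable solution (u_ε, v_ε, w_ε) : ℝ → ℝ³ of the traveling-wave system u′ = v, v′ = −c v − f(u) + w, w′ = −(ε/c)(u − γ w − a), which is periodic with minimal period L_ε and satisfies |ε L_ε − (L_l + L_r)| ≤ C ε^{1/3}. -/

import Mathlib

open Real MeasureTheory

noncomputable def fcube (a u : ℝ) : ℝ := u * (u - a) * (1 - u)

noncomputable def uOne (a : ℝ) : ℝ := (1 + a - Real.sqrt (1 - a + a ^ 2)) / 3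
noncomputable def uBarOne (a : ℝ) : ℝ := (1 + a + Real.sqrt (1 - a + a ^ 2)) / 3
noncomputable def uTwo (a : ℝ) : ℝ := (1 + a + 2 * Real.sqrt (1 - a + a ^ 2)) / 3
noncomputable def uBarTwo (a : ℝ) : ℝ := (1 + a - 2 * Real.sqrt (1 - a + a ^ 2)) / 3

noncomputable def gammaStar (a : ℝ) : ℝ :=
  9 / (1 + 2 * a - 2 * a ^ 2 + (1 - 2 * a) * Real.sqrt (a ^ 2 - a + 1))

noncomputable def cStar (a : ℝ) : ℝ := Real.sqrt ((1 - a + a ^ 2) / 2)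

noncomputable def Lleft (a γ c : ℝ) : ℝ :=
  ∫ u in (uOne a)..(uBarTwo a), -c * deriv (fcube a) u / (u - γ * fcube a u - a)

noncomputable def Lright (a γ c : ℝ) : ℝ :=
  ∫ u in (uBarOne a)..(uTwo a), -c * deriv (fcube a) u / (u - γ * fcube a u - a)

theorem ptw_global_sol {E : Type*} [NormedAddCommGroup E] [NormedSpace ℝ E] [CompleteSpace E]
    (V : E → E) (K : NNReal) (hV : LipschitzWith K V) (x : E) :
    ∃ α : ℝ → E, α 0 = x ∧ ∀ t, HasDerivAt α (V (α t)) t := by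
  classical
  -- local existence with uniform time
  set τ : ℝ := 1 / (K + 1) with hτ
  have hK : (0:ℝ) ≤ K := K.2
  have hτ0 : 0 < τ := by positivity
  have h0 : ∀ x : E, ∃ α : ℝ → E, α 0 = x ∧ ∀ t ∈ Set.Ioo (-τ) τ, HasDerivAt α (V (α t)) t := by
    intro x
    set a : NNReal := ‖V x‖₊ + 1 with ha
    set L : NNReal := ‖V x‖₊ + K * a with hL
    have hpl : IsPicardLindelof (fun _ => V) (tmin := -τ) (tmax := τ)
        (⟨0, by constructor <;> linarith⟩ : Set.Icc (-τ) τ) x a 0 L K := by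
      apply IsPicardLindelof.of_time_independent
      · intro z hz
        have h1 : ‖V z - V x‖ ≤ K * ‖z - x‖ := by
          simpa [dist_eq_norm] using hV.dist_le_mul z x
        have h2 : ‖z - x‖ ≤ a := by simpa [dist_eq_norm] using hz
        have h3 : ‖V z‖ ≤ ‖V x‖ + ‖V z - V x‖ := by
          have := norm_add_le (V x) (V z - V x)
          simpa using this
        have h4 : (K:ℝ) * ‖z - x‖ ≤ K * a := by gcongr
        have : (L:ℝ) = ‖V x‖ + K * a := by simp [hL]
        linarith
      · exact hV.lipschitzOnWith
      · have e1 : (a:ℝ) = ‖V x‖ + 1 := by simp [ha]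
        have e2 : (L:ℝ) = ‖V x‖ + K * a := by simp [hL]
        have e3 : max (τ - 0) (0 - -τ) = τ := by simp
        simp only [e3]
        rw [e2, hτ, mul_one_div, div_le_iff₀ (by positivity), e1]
        have := norm_nonneg (V x)
        simp
        nlinarith
    obtain ⟨α, h1, h2⟩ := hpl.exists_eq_forall_mem_Icc_hasDerivWithinAt₀
    exact ⟨α, h1, fun t ht => (h2 t (Set.Ioo_subset_Icc_self ht)).hasDerivAt
      (Icc_mem_nhds ht.1 ht.2)⟩
  have uniq : ∀ (a b t₀ : ℝ) (f g : ℝ → E), t₀ ∈ Set.Ioo a b →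
      (∀ t ∈ Set.Ioo a b, HasDerivAt f (V (f t)) t) →
      (∀ t ∈ Set.Ioo a b, HasDerivAt g (V (g t)) t) → f t₀ = g t₀ → Set.EqOn f g (Set.Ioo a b) := by
    intro a b t₀ f g ht hf hg he
    exact ODE_solution_unique_of_mem_Ioo (v := fun _ => V) (s := fun _ => Set.univ) (K := K)
      (fun t _ => hV.lipschitzOnWith) ht (fun t h => ⟨hf t h, trivial⟩)
      (fun t h => ⟨hg t h, trivial⟩) he
  have step : ∀ T : ℝ, 0 < T →
      (∀ x : E, ∃ α : ℝ → E, α 0 = x ∧ ∀ t ∈ Set.Ioo (-T) T, HasDerivAt α (V (α t)) t) →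
      (∀ x : E, ∃ α : ℝ → E, α 0 = x ∧
        ∀ t ∈ Set.Ioo (-(3/2*T)) (3/2*T), HasDerivAt α (V (α t)) t) := by
    intro T hT H x
    obtain ⟨α, hα0, hα⟩ := H x
    obtain ⟨β, hβ0, hβ⟩ := H (α (T/2))
    obtain ⟨γ, hγ0, hγ⟩ := H (α (-(T/2)))
    have hβ' : ∀ t ∈ Set.Ioo (-(T/2)) (3/2*T),
        HasDerivAt (fun s => β (s - T/2)) (V (β (t - T/2))) t := by
      intro t ht
      exact HasDerivAt.comp_sub_const t (T/2) (hβ (t - T/2) ⟨by linarith [ht.1], by linarith [ht.2]⟩)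
    have hγ' : ∀ t ∈ Set.Ioo (-(3/2*T)) (T/2),
        HasDerivAt (fun s => γ (s + T/2)) (V (γ (t + T/2))) t := by
      intro t ht
      exact HasDerivAt.comp_add_const t (T/2) (hγ (t + T/2) ⟨by linarith [ht.1], by linarith [ht.2]⟩)
    have e1 : Set.EqOn (fun s => β (s - T/2)) α (Set.Ioo (-(T/2)) T) := by
      apply uniq _ _ (T/2) _ _ ⟨by linarith, by linarith⟩
      · exact fun t ht => hβ' t ⟨ht.1, by linarith [ht.2]⟩
      · exact fun t ht => hα t ⟨by linarith [ht.1], ht.2⟩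
      · simpa using hβ0
    have e2 : Set.EqOn (fun s => γ (s + T/2)) α (Set.Ioo (-T) (T/2)) := by
      apply uniq _ _ (-(T/2)) _ _ ⟨by linarith, by linarith⟩
      · exact fun t ht => hγ' t ⟨by linarith [ht.1], ht.2⟩
      · exact fun t ht => hα t ⟨ht.1, by linarith [ht.2]⟩
      · simpa using hγ0
    refine ⟨fun t => if 0 ≤ t then β (t - T/2) else γ (t + T/2), ?_, ?_⟩
    · have := e1 (x := 0) ⟨by linarith, by linarith⟩
      simp only [le_refl, if_true]
      rw [← hα0]; exact this
    · intro t ht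
      rcases lt_trichotomy t 0 with h | h | h
      · have h2 := hγ' t ⟨ht.1, by linarith⟩
        have e : (fun t => if 0 ≤ t then β (t - T/2) else γ (t + T/2)) =ᶠ[nhds t]
            (fun s => γ (s + T/2)) := by
          filter_upwards [Iio_mem_nhds h] with s hs
          rw [if_neg (not_le.mpr hs)]
        have := h2.congr_of_eventuallyEq e
        have e' := e.eq_of_nhds
        beta_reduce at e' ⊢
        rw [e']
        exact this
      · have e : (fun t => if 0 ≤ t then β (t - T/2) else γ (t + T/2)) =ᶠ[nhds t] α := by
          have : Set.Ioo (-(T/2)) (T/2) ∈ nhds t :=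
            Ioo_mem_nhds (by linarith) (by linarith)
          filter_upwards [this] with s hs
          split_ifs
          · exact e1 ⟨hs.1, by linarith [hs.2]⟩
          · exact e2 ⟨by linarith [hs.1], hs.2⟩
        have h2 := hα t ⟨by linarith, by linarith⟩
        have := h2.congr_of_eventuallyEq e
        have e' := e.eq_of_nhds
        beta_reduce at e' ⊢
        rw [e']
        exact this
      · have h2 := hβ' t ⟨by linarith, ht.2⟩
        have e : (fun t => if 0 ≤ t then β (t - T/2) else γ (t + T/2)) =ᶠ[nhds t]
            (fun s => β (s - T/2)) := by
          filter_upwards [Ioi_mem_nhds h] with s hs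
          rw [if_pos (le_of_lt hs)]
        have := h2.congr_of_eventuallyEq e
        have e' := e.eq_of_nhds
        beta_reduce at e' ⊢
        rw [e']
        exact this
  have hn : ∀ n : ℕ, ∀ x : E, ∃ α : ℝ → E, α 0 = x ∧
      ∀ t ∈ Set.Ioo (-((3/2)^n*τ)) ((3/2)^n*τ), HasDerivAt α (V (α t)) t := by
    intro n
    induction n with
    | zero => simpa using h0
    | succ n ih =>
      have := step _ (by positivity) ih
      intro x
      obtain ⟨α, h1, h2⟩ := this x
      refine ⟨α, h1, fun t ht => h2 t ?_⟩
      rw [pow_succ] at ht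
      constructor
      · linarith [ht.1]
      · linarith [ht.2]
  choose A hA0 hA using fun n => hn n x
  have hlim : Filter.Tendsto (fun n : ℕ => ((3/2:ℝ))^n*τ) Filter.atTop Filter.atTop :=
    (tendsto_pow_atTop_atTop_of_one_lt (by norm_num)).atTop_mul_const hτ0
  have hN : ∀ t : ℝ, ∃ n : ℕ, |t| < (3/2)^n*τ := by
    intro t
    exact (hlim.eventually (Filter.eventually_gt_atTop |t|)).exists
  choose N hN using hN
  have agree : ∀ n m t, |t| < (3/2)^n*τ → |t| < (3/2)^m*τ → A n t = A m t := by
    intro n m t h1 h2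
    set r := min (((3/2:ℝ))^n*τ) ((3/2)^m*τ) with hr
    have hr0 : 0 < r := by positivity
    refine uniq (-r) r 0 (A n) (A m) ⟨by linarith, hr0⟩ ?_ ?_ ?_ ?_
    · intro s hs
      exact hA n s ⟨by linarith [hs.1, min_le_left (((3/2:ℝ))^n*τ) ((3/2)^m*τ)],
        by linarith [hs.2, min_le_left (((3/2:ℝ))^n*τ) ((3/2)^m*τ)]⟩
    · intro s hs
      exact hA m s ⟨by linarith [hs.1, min_le_right (((3/2:ℝ))^n*τ) ((3/2)^m*τ)],
        by linarith [hs.2, min_le_right (((3/2:ℝ))^n*τ) ((3/2)^m*τ)]⟩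
    · rw [hA0, hA0]
    · have : |t| < r := lt_min h1 h2
      exact ⟨(abs_lt.mp this).1, (abs_lt.mp this).2⟩
  refine ⟨fun t => A (N t) t, hA0 _, fun t => ?_⟩
  have h2 := hA (N t) t ⟨(abs_lt.mp (hN t)).1, (abs_lt.mp (hN t)).2⟩
  have e : (fun t => A (N t) t) =ᶠ[nhds t] A (N t) := by
    have : {s : ℝ | |s| < (3/2)^(N t)*τ} ∈ nhds t :=
      (isOpen_lt continuous_abs continuous_const).mem_nhds (hN t)
    filter_upwards [this] with s hs
    exact agree _ _ _ (hN s) hs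
  exact h2.congr_of_eventuallyEq e

theorem ptw_flow {E : Type*} [NormedAddCommGroup E] [NormedSpace ℝ E] [CompleteSpace E]
    (V : E → E) (K : NNReal) (hV : LipschitzWith K V) :
    ∃ φ : E → ℝ → E, (∀ x, φ x 0 = x) ∧ (∀ x t, HasDerivAt (φ x) (V (φ x t)) t) ∧
      Continuous (fun p : E × ℝ => φ p.1 |p.2|) ∧
      (∀ f : ℝ → E, (∀ t, HasDerivAt f (V (f t)) t) → f = φ (f 0)) := by
  choose φ h0 h1 using ptw_global_sol V K hV
  refine ⟨φ, h0, h1, ?_, ?_⟩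
  · have key : ∀ x y t, 0 ≤ t → dist (φ x t) (φ y t) ≤ dist x y * Real.exp (K * t) := by
      intro x y t ht
      have := dist_le_of_trajectories_ODE (v := fun _ => V) (K := K) (f := φ x) (g := φ y)
        (a := 0) (b := t) (δ := dist x y) (fun _ => hV)
        (fun s _ => (h1 x s).continuousAt.continuousWithinAt)
        (fun s _ => (h1 x s).hasDerivWithinAt)
        (fun s _ => (h1 y s).continuousAt.continuousWithinAt)
        (fun s _ => (h1 y s).hasDerivWithinAt) (by rw [h0, h0]) t ⟨ht, le_rfl⟩
      simpa using this
    rw [continuous_iff_continuousAt]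
    rintro ⟨x, t⟩
    rw [ContinuousAt, tendsto_iff_dist_tendsto_zero]
    have hc : Continuous (φ x) := continuous_iff_continuousAt.mpr fun s => (h1 x s).continuousAt
    have hb : Filter.Tendsto (fun p : E × ℝ => dist p.1 x * Real.exp (K * |p.2|) +
        dist (φ x |p.2|) (φ x |t|)) (nhds (x, t)) (nhds 0) := by
      have : Continuous (fun p : E × ℝ => dist p.1 x * Real.exp (K * |p.2|) +
        dist (φ x |p.2|) (φ x |t|)) := by fun_prop
      have h := this.tendsto (x, t)
      simpa using h
    refine squeeze_zero (fun _ => dist_nonneg) (fun p => ?_) hb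
    exact (dist_triangle _ (φ x |p.2|) _).trans (by gcongr; exact key _ _ _ (abs_nonneg _))
  · intro f hf
    exact ODE_solution_unique_univ (v := fun _ => V) (s := fun _ => Set.univ) (K := K) (t₀ := 0)
      (fun t => hV.lipschitzOnWith) (fun t => ⟨hf t, trivial⟩)
      (fun t => ⟨h1 _ t, trivial⟩) (by rw [h0])

theorem ptw_trap (h : ℝ → ℝ) (a b l r : ℝ) (hc : Continuous h)
    (ha : l < h a ∧ h a < r) (hn : ∀ t ∈ Set.uIcc a b, h t ≠ l ∧ h t ≠ r) :
    l < h b ∧ h b < r := by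
  have hiv := intermediate_value_uIcc (a := a) (b := b) hc.continuousOn
  constructor
  · by_contra hh
    have hm : l ∈ Set.uIcc (h a) (h b) := by
      rw [Set.mem_uIcc]; right; exact ⟨not_lt.mp hh, ha.1.le⟩
    obtain ⟨t, ht, e⟩ := hiv hm
    exact (hn t ht).1 e
  · by_contra hh
    have hm : r ∈ Set.uIcc (h a) (h b) := by
      rw [Set.mem_uIcc]; left; exact ⟨ha.2.le, not_lt.mp hh⟩
    obtain ⟨t, ht, e⟩ := hiv hm
    exact (hn t ht).2 e

theorem ptw_miranda_strict (F1 F2 : ℝ × ℝ → ℝ) (h1 : Continuous F1) (h2 : Continuous F2)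
    (x0 x1 y0 y1 : ℝ) (hx : x0 ≤ x1) (hy : y0 ≤ y1)
    (hl : ∀ y ∈ Set.Icc y0 y1, F1 (x0, y) < 0) (hr : ∀ y ∈ Set.Icc y0 y1, 0 < F1 (x1, y))
    (hb : ∀ x ∈ Set.Icc x0 x1, F2 (x, y0) < 0) (ht : ∀ x ∈ Set.Icc x0 x1, 0 < F2 (x, y1)) :
    ∃ p : ℝ × ℝ, p.1 ∈ Set.Icc x0 x1 ∧ p.2 ∈ Set.Icc y0 y1 ∧ F1 p = 0 ∧ F2 p = 0 := by
  by_contra hcon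
  push Not at hcon
  set cl : ℝ × ℝ → ℝ × ℝ := fun p => (max x0 (min p.1 x1), max y0 (min p.2 y1)) with hcl
  have hclc : Continuous cl := by fun_prop
  have m1 : ∀ p, (cl p).1 ∈ Set.Icc x0 x1 := fun p =>
    ⟨le_max_left _ _, max_le hx (min_le_right _ _)⟩
  have m2 : ∀ p, (cl p).2 ∈ Set.Icc y0 y1 := fun p =>
    ⟨le_max_left _ _, max_le hy (min_le_right _ _)⟩
  set G : ℝ × ℝ → ℂ := fun p => ⟨F1 (cl p), F2 (cl p)⟩ with hG
  have hGc : Continuous G := by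
    have : G = fun p => ((F1 (cl p) : ℂ) + (F2 (cl p) : ℂ) * Complex.I) := by
      funext p; apply Complex.ext <;> simp [hG]
    rw [this]; fun_prop
  have hG0 : ∀ p, G p ≠ 0 := by
    intro p hp
    have e1 : F1 (cl p) = 0 := congrArg Complex.re hp
    have e2 : F2 (cl p) = 0 := congrArg Complex.im hp
    exact hcon _ (m1 p) (m2 p) e1 e2
  have hsc : IsSimplyConnected (Set.univ : Set (ℝ × ℝ)) := by
    have : ContractibleSpace (Set.univ : Set (ℝ × ℝ)) :=
      (convex_univ : Convex ℝ (Set.univ : Set (ℝ × ℝ))).contractibleSpace Set.univ_nonempty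
    exact (inferInstance : SimplyConnectedSpace (Set.univ : Set (ℝ × ℝ)))
  obtain ⟨g, hgc, hg⟩ := Complex.exists_continuousOn_eqOn_exp_comp hsc isOpen_univ
    (g := G) hGc.continuousOn (by rintro ⟨p, -, hp⟩; exact hG0 p hp)
  have hgc' : Continuous g := continuousOn_univ.mp hgc
  have hg' : ∀ p, Complex.exp (g p) = G p := fun p => hg (Set.mem_univ p)
  set θ0 : ℝ := Complex.arg (G (x1, y0)) with hθ0
  obtain ⟨k, hk⟩ : ∃ k : ℤ, g (x1, y0) = Complex.log (G (x1,y0)) + k * (2 * π * Complex.I) := by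
    apply Complex.exp_eq_exp_iff_exists_int.mp
    rw [hg', Complex.exp_log (hG0 _)]
  set θ : ℝ × ℝ → ℝ := fun p => (g p).im - k * (2 * π) with hθ
  have hθc : Continuous θ := by fun_prop
  have hcos : ∀ p, F1 (cl p) = Real.exp (g p).re * Real.cos (θ p) := by
    intro p
    have := congrArg Complex.re (hg' p)
    rw [Complex.exp_re] at this
    simp only [hθ, Real.cos_sub_int_mul_two_pi]
    exact this.symm
  have hsin : ∀ p, F2 (cl p) = Real.exp (g p).re * Real.sin (θ p) := by
    intro p
    have := congrArg Complex.im (hg' p)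
    rw [Complex.exp_im] at this
    simp only [hθ, Real.sin_sub_int_mul_two_pi]
    exact this.symm
  have clid : ∀ x y, x ∈ Set.Icc x0 x1 → y ∈ Set.Icc y0 y1 → cl (x,y) = (x,y) := by
    intro x y h h'
    simp [hcl, min_eq_left h.2, max_eq_right h.1, min_eq_left h'.2, max_eq_right h'.1]
  have cosR : ∀ y ∈ Set.Icc y0 y1, 0 < Real.cos (θ (x1, y)) := by
    intro y hy'
    have h := hcos (x1, y)
    rw [clid x1 y ⟨hx, le_rfl⟩ hy'] at h
    have := hr y hy'
    rw [h] at this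
    exact (pos_iff_pos_of_mul_pos this).mp (Real.exp_pos _)
  have cosL : ∀ y ∈ Set.Icc y0 y1, Real.cos (θ (x0, y)) < 0 := by
    intro y hy'
    have h := hcos (x0, y)
    rw [clid x0 y ⟨le_rfl, hx⟩ hy'] at h
    have := hl y hy'
    rw [h] at this
    exact neg_of_mul_neg_right this (Real.exp_pos _).le
  have sinT : ∀ x ∈ Set.Icc x0 x1, 0 < Real.sin (θ (x, y1)) := by
    intro x hx'
    have h := hsin (x, y1)
    rw [clid x y1 hx' ⟨hy, le_rfl⟩] at h
    have := ht x hx'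
    rw [h] at this
    exact (pos_iff_pos_of_mul_pos this).mp (Real.exp_pos _)
  have sinB : ∀ x ∈ Set.Icc x0 x1, Real.sin (θ (x, y0)) < 0 := by
    intro x hx'
    have h := hsin (x, y0)
    rw [clid x y0 hx' ⟨le_rfl, hy⟩] at h
    have := hb x hx'
    rw [h] at this
    exact neg_of_mul_neg_right this (Real.exp_pos _).le
  have hpi := Real.pi_pos
  -- start
  have s0 : θ (x1, y0) = θ0 := by
    simp only [hθ, hk, hθ0]
    simp [Complex.log_im]
  have b0 : -(π/2) < θ (x1,y0) ∧ θ (x1,y0) < 0 := by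
    have hF1 : 0 < (G (x1,y0)).re := by
      simp only [hG]; rw [clid _ _ ⟨hx, le_rfl⟩ ⟨le_rfl, hy⟩]; exact hr _ ⟨le_rfl, hy⟩
    have hF2 : (G (x1,y0)).im < 0 := by
      simp only [hG]; rw [clid _ _ ⟨hx, le_rfl⟩ ⟨le_rfl, hy⟩]; exact hb _ ⟨hx, le_rfl⟩
    rw [s0]
    constructor
    · have := (Complex.abs_arg_lt_pi_div_two_iff (z := G (x1,y0))).mpr (Or.inl hF1)
      exact (abs_lt.mp this).1
    · exact Complex.arg_neg_iff.mpr hF2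
  have q1 := ptw_trap (fun t => θ (x1, t)) y0 y1 (-(π/2)) (π/2) (by fun_prop)
    ⟨b0.1, by linarith [b0.2]⟩ (by
      intro t htt
      rw [Set.uIcc_of_le hy] at htt
      have := cosR t htt
      constructor <;> intro e <;> simp only [e] at this <;> simp at this)
  have q1' : 0 < θ (x1,y1) := by
    by_contra hh
    have := sinT x1 ⟨hx, le_rfl⟩
    have h3 := Real.sin_nonpos_of_nonpos_of_neg_pi_le (not_lt.mp hh) (by linarith [q1.1])
    linarith
  have q2 := ptw_trap (fun t => θ (t, y1)) x1 x0 0 π (by fun_prop)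
    ⟨q1', by linarith [q1.2]⟩ (by
      intro t htt
      rw [Set.uIcc_of_ge hx] at htt
      have := sinT t htt
      constructor <;> intro e <;> simp only [e] at this <;> simp at this)
  have q2' : π/2 < θ (x0,y1) := by
    by_contra hh
    have := cosL y1 ⟨hy, le_rfl⟩
    have h3 := Real.cos_nonneg_of_mem_Icc (x := θ (x0,y1)) ⟨by linarith [q2.1], not_lt.mp hh⟩
    linarith
  have q3 := ptw_trap (fun t => θ (x0, t)) y1 y0 (π/2) (π + π/2) (by fun_prop)
    ⟨q2', by linarith [q2.2]⟩ (by
      intro t htt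
      rw [Set.uIcc_of_ge hy] at htt
      have := cosL t htt
      constructor <;> intro e <;> simp only [e] at this <;> simp [Real.cos_add] at this)
  have q3' : π < θ (x0,y0) := by
    by_contra hh
    have := sinB x0 ⟨le_rfl, hx⟩
    have h3 := Real.sin_nonneg_of_nonneg_of_le_pi (x := θ (x0,y0)) (by linarith [q3.1]) (not_lt.mp hh)
    linarith
  have q4 := ptw_trap (fun t => θ (t, y0)) x0 x1 π (2*π) (by fun_prop)
    ⟨q3', by linarith [q3.2]⟩ (by
      intro t htt
      rw [Set.uIcc_of_le hx] at htt
      have := sinB t htt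
      constructor <;> intro e <;> simp only [e] at this <;> simp at this)
  have : π < θ (x1,y0) := q4.1
  linarith [b0.2]

theorem ptw_miranda (F1 F2 : ℝ × ℝ → ℝ) (h1 : Continuous F1) (h2 : Continuous F2)
    (x0 x1 y0 y1 : ℝ) (hx : x0 ≤ x1) (hy : y0 < y1)
    (hl : ∀ y ∈ Set.Icc y0 y1, F1 (x0, y) < 0) (hr : ∀ y ∈ Set.Icc y0 y1, 0 < F1 (x1, y))
    (hb : ∀ x ∈ Set.Icc x0 x1, F2 (x, y0) ≤ 0) (ht : ∀ x ∈ Set.Icc x0 x1, 0 ≤ F2 (x, y1)) :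
    ∃ p : ℝ × ℝ, p.1 ∈ Set.Icc x0 x1 ∧ p.2 ∈ Set.Icc y0 y1 ∧ F1 p = 0 ∧ F2 p = 0 := by
  by_contra hcon
  push Not at hcon
  have hcomp : IsCompact (Set.Icc x0 x1 ×ˢ Set.Icc y0 y1) := isCompact_Icc.prod isCompact_Icc
  have hne : (Set.Icc x0 x1 ×ˢ Set.Icc y0 y1).Nonempty :=
    ⟨(x0, y0), ⟨le_rfl, hx⟩, ⟨le_rfl, hy.le⟩⟩
  obtain ⟨p0, hp0, hmin⟩ := hcomp.exists_isMinOn hne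
    (f := fun p => |F1 p| + |F2 p|) (by fun_prop)
  have hm : 0 < |F1 p0| + |F2 p0| := by
    by_cases h : F1 p0 = 0
    · have := hcon p0 hp0.1 hp0.2 h
      have := abs_pos.mpr this
      positivity
    · have := abs_pos.mpr h
      positivity
  set m := |F1 p0| + |F2 p0| with hmdef
  set η := m / (2 * (y1 - y0)) with hη
  have hyy : 0 < y1 - y0 := by linarith
  have hη0 : 0 < η := by positivity
  obtain ⟨p, hp1, hp2, e1, e2⟩ := ptw_miranda_strict F1
    (fun p => F2 p + η * (p.2 - (y0+y1)/2)) h1 (by fun_prop) x0 x1 y0 y1 hx hy.le hl hr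
    (by intro x hx'; have := hb x hx'; simp only; nlinarith)
    (by intro x hx'; have := ht x hx'; simp only; nlinarith)
  have h3 := hmin (show p ∈ Set.Icc x0 x1 ×ˢ Set.Icc y0 y1 from ⟨hp1, hp2⟩)
  simp only [Set.mem_ofPred_eq] at h3
  have h4 : |F2 p| ≤ m / 2 := by
    have : F2 p = -(η * (p.2 - (y0+y1)/2)) := by linarith
    rw [this, abs_neg, abs_mul, abs_of_pos hη0]
    have h5 : |p.2 - (y0+y1)/2| ≤ y1 - y0 := by
      rw [abs_le]; constructor <;> linarith [hp2.1, hp2.2]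
    calc η * |p.2 - (y0+y1)/2| ≤ η * (y1 - y0) := by gcongr
      _ = m / 2 := by rw [hη]; field_simp
  rw [e1] at h3
  simp at h3
  linarith

theorem ptw_exit_continuous {X : Type*} [TopologicalSpace X] (E : X → ℝ → ℝ)
    (hE : Continuous (fun p : X × ℝ => E p.1 |p.2|)) (T : X → ℝ) (hT : ∀ x, 0 ≤ T x)
    (hneg : ∀ x, ∀ t, 0 ≤ t → t < T x → E x t < 0) (hz : ∀ x, E x (T x) = 0)
    (hpos : ∀ x, ∀ h > 0, ∃ t, T x < t ∧ t < T x + h ∧ 0 < E x t) : Continuous T := by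
  rw [continuous_iff_continuousAt]
  intro x
  rw [ContinuousAt, tendsto_order]
  constructor
  · intro a ha
    rcases lt_or_ge a 0 with h | h
    · exact Filter.Eventually.of_forall fun y => lt_of_lt_of_le h (hT y)
    · have hopen : IsOpen {p : X × ℝ | E p.1 |p.2| < 0} := isOpen_lt hE continuous_const
      have hsub : ({x} : Set X) ×ˢ (Set.Icc 0 a) ⊆ {p : X × ℝ | E p.1 |p.2| < 0} := by
        rintro ⟨x', t⟩ ⟨hx', ht⟩
        simp only [Set.mem_singleton_iff] at hx'
        subst hx'
        simp only [Set.mem_ofPred_eq]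
        rw [abs_of_nonneg ht.1]
        exact hneg _ _ ht.1 (lt_of_le_of_lt ht.2 ha)
      obtain ⟨u, v, hu, hv, hxu, hav, huv⟩ := generalized_tube_lemma isCompact_singleton
        isCompact_Icc hopen hsub
      filter_upwards [hu.mem_nhds (hxu rfl)] with y hyu
      by_contra hh
      have hh' : T y ≤ a := not_lt.mp hh
      have := huv (show (y, T y) ∈ u ×ˢ v from ⟨hyu, hav ⟨hT y, hh'⟩⟩)
      simp only [Set.mem_ofPred_eq] at this
      rw [abs_of_nonneg (hT y), hz] at this
      exact lt_irrefl _ this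
  · intro b hb
    obtain ⟨t, h1, h2, h3⟩ := hpos x (b - T x) (by linarith)
    have ht0 : 0 ≤ t := (hT x).trans h1.le
    have hc : Continuous (fun y => E y |t|) := hE.comp (by fun_prop : Continuous fun y : X => (y, t))
    rw [abs_of_nonneg ht0] at hc
    filter_upwards [(isOpen_lt continuous_const hc).mem_nhds h3] with y hy
    by_contra hh
    have := hneg y t ht0 (by linarith)
    have hy' : 0 < E y t := hy
    linarith

theorem ptw_last (f : ℝ → ℝ) (hf : Continuous f) (a b : ℝ) (hab : a ≤ b) (ha : f a ≤ 0)
    (hb : 0 < f b) : ∃ s, a ≤ s ∧ s < b ∧ f s = 0 ∧ ∀ t, s < t → t ≤ b → 0 < f t := by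
  set S : Set ℝ := Set.Icc a b ∩ {t | f t ≤ 0} with hS
  have hSc : IsCompact S := isCompact_Icc.inter_right (isClosed_le hf continuous_const)
  obtain ⟨s, hs, hmax⟩ := hSc.exists_isMaxOn (f := fun t : ℝ => t) ⟨a, ⟨le_rfl, hab⟩, ha⟩
    continuous_id.continuousOn
  have hs0 : f s ≤ 0 := hs.2
  have hsb : s < b := by
    rcases lt_or_eq_of_le hs.1.2 with h | h
    · exact h
    · rw [h] at hs0; linarith
  have hpos : ∀ t, s < t → t ≤ b → 0 < f t := by
    intro t h1 h2
    by_contra hh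
    have : t ≤ s := hmax (show t ∈ S from ⟨⟨hs.1.1.trans h1.le, h2⟩, not_lt.mp hh⟩)
    linarith
  refine ⟨s, hs.1.1, hsb, le_antisymm hs0 ?_, hpos⟩
  by_contra hh
  have hn : f s < 0 := not_le.mp hh
  obtain ⟨r, hr, hr0⟩ := intermediate_value_Icc hsb.le hf.continuousOn
    (show (0:ℝ) ∈ Set.Icc (f s) (f b) from ⟨hn.le, hb.le⟩)
  have : s ≠ r := by rintro rfl; linarith
  have := hpos r (lt_of_le_of_ne hr.1 this) hr.2
  linarith

theorem ptw_first (f : ℝ → ℝ) (hf : Continuous f) (a b : ℝ) (hab : a ≤ b) (ha : f a < 0)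
    (hb : 0 ≤ f b) : ∃ s, a < s ∧ s ≤ b ∧ f s = 0 ∧ ∀ t, a ≤ t → t < s → f t < 0 := by
  obtain ⟨s, h1, h2, h3, h4⟩ := ptw_last (fun t => - f (-t)) (by fun_prop) (-b) (-a) (by linarith)
    (by simpa using hb) (by simpa using ha)
  refine ⟨-s, by linarith, by linarith, by linarith, fun t ht1 ht2 => ?_⟩
  have := h4 (-t) (by linarith) (by linarith)
  simp at this
  exact this

theorem ptw_anti (φ φ' : ℝ → ℝ) (a b : ℝ) (hd : ∀ t, HasDerivAt φ (φ' t) t) (hab : a ≤ b)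
    (h : ∀ t, a < t → t < b → φ' t ≤ 0) : φ b ≤ φ a := by
  have := antitoneOn_of_deriv_nonpos (convex_Icc a b)
    (f := φ) (fun t _ => (hd t).continuousAt.continuousWithinAt)
    (fun t _ => (hd t).differentiableAt.differentiableWithinAt)
    (fun t ht => by
      rw [interior_Icc] at ht
      rw [(hd t).deriv]; exact h t ht.1 ht.2)
  exact this ⟨le_rfl, hab⟩ ⟨hab, le_rfl⟩ hab

theorem ptw_upper (φ φ' : ℝ → ℝ) (a b ρ : ℝ) (hd : ∀ t, HasDerivAt φ (φ' t) t) (hab : a ≤ b)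
    (h : ∀ t, a < t → t < b → φ' t ≤ ρ) : φ b ≤ φ a + ρ * (b - a) := by
  have := ptw_anti (fun t => φ t - ρ * t) (fun t => φ' t - ρ * 1) a b
    (fun t => (hd t).sub ((hasDerivAt_id t).const_mul ρ)) hab
    (fun t h1 h2 => by linarith [h t h1 h2])
  linarith

theorem ptw_lower (φ φ' : ℝ → ℝ) (a b ρ : ℝ) (hd : ∀ t, HasDerivAt φ (φ' t) t) (hab : a ≤ b)
    (h : ∀ t, a < t → t < b → ρ ≤ φ' t) : φ a + ρ * (b - a) ≤ φ b := by
  have := ptw_upper (fun t => - φ t) (fun t => - φ' t) a b (-ρ)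
    (fun t => (hd t).neg) hab (fun t h1 h2 => by linarith [h t h1 h2])
  linarith

theorem ptw_decay (φ φ' : ℝ → ℝ) (a b ρ : ℝ) (hd : ∀ t, HasDerivAt φ (φ' t) t) (hab : a ≤ b)
    (h : ∀ t, a ≤ t → t ≤ b → 0 < φ t → φ' t ≤ -ρ) (hρ : 0 ≤ ρ) :
    φ b ≤ 0 ∨ φ b ≤ φ a - ρ * (b - a) := by
  by_contra hh
  push Not at hh
  have hc : Continuous φ := continuous_iff_continuousAt.mpr fun t => (hd t).continuousAt
  rcases le_or_gt (φ a) 0 with h0 | h0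
  · obtain ⟨s, h1, h2, h3, h4⟩ := ptw_last φ hc a b hab h0 hh.1
    have := ptw_upper φ φ' s b (-ρ) hd h2.le
      (fun t ht ht' => h t (by linarith) ht'.le (h4 t ht ht'.le))
    nlinarith
  · by_cases hx : ∃ t, a ≤ t ∧ t ≤ b ∧ φ t ≤ 0
    · obtain ⟨t, ht1, ht2, ht3⟩ := hx
      obtain ⟨s, h1, h2, h3, h4⟩ := ptw_last φ hc t b ht2 ht3 hh.1
      have := ptw_upper φ φ' s b (-ρ) hd h2.le
        (fun t ht ht' => h t (by linarith) ht'.le (h4 t ht ht'.le))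
      nlinarith
    · push Not at hx
      have := ptw_upper φ φ' a b (-ρ) hd hab
        (fun t ht ht' => h t ht.le ht'.le (hx t ht.le ht'.le))
      linarith

theorem ptw_decay0 (φ φ' : ℝ → ℝ) (a b : ℝ) (hd : ∀ t, HasDerivAt φ (φ' t) t) (hab : a ≤ b)
    (h : ∀ t, a ≤ t → t ≤ b → 0 < φ t → φ' t ≤ 0) (h0 : φ a ≤ 0) : φ b ≤ 0 := by
  rcases ptw_decay φ φ' a b 0 hd hab (by simpa using h) le_rfl with h | h <;> linarith

theorem ptw_sign_right (f : ℝ → ℝ) (d s : ℝ) (hd : HasDerivAt f d s) (h0 : 0 < d) :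
    ∃ r > 0, ∀ t, s < t → t < s + r → f s < f t := by
  have h1 := (hasDerivAt_iff_tendsto_slope.mp hd).eventually (lt_mem_nhds h0)
  rw [eventually_nhdsWithin_iff, Metric.eventually_nhds_iff] at h1
  obtain ⟨r, hr, h⟩ := h1
  refine ⟨r, hr, fun t h1 h2 => ?_⟩
  have h3 := @h t (by rw [Real.dist_eq, abs_of_pos (by linarith)]; linarith) (by simp; linarith)
  rw [slope_def_field] at h3
  have := (div_pos_iff_of_pos_right (show 0 < t - s by linarith)).mp h3
  linarith

theorem ptw_sign_left (f : ℝ → ℝ) (d s : ℝ) (hd : HasDerivAt f d s) (h0 : 0 < d) :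
    ∃ r > 0, ∀ t, s - r < t → t < s → f t < f s := by
  have h2 : HasDerivAt (fun t => - f (-t)) d (-s) := by
    have h3 : HasDerivAt f d (-(-s)) := by simpa using hd
    have := (h3.comp (-s) (hasDerivAt_neg (-s))).neg
    have e : -(d * -1) = d := by ring
    rw [e] at this
    exact this
  obtain ⟨r, hr, h⟩ := ptw_sign_right (fun t => - f (-t)) d (-s) h2 h0
  refine ⟨r, hr, fun t h1 h2 => ?_⟩
  have := h (-t) (by linarith) (by linarith)
  simp at this
  exact this

theorem ptw_strict (φ φ' : ℝ → ℝ) (a b : ℝ) (hd : ∀ t, HasDerivAt φ (φ' t) t) (hab : a ≤ b)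
    (h : ∀ t, a ≤ t → t ≤ b → φ t = 0 → φ' t < 0) (h0 : φ a < 0) : φ b < 0 := by
  by_contra hh
  have hc : Continuous φ := continuous_iff_continuousAt.mpr fun t => (hd t).continuousAt
  obtain ⟨s, h1, h2, h3, h4⟩ := ptw_first φ hc a b hab h0 (not_lt.mp hh)
  have h5 := h s h1.le h2 h3
  obtain ⟨r, hr, h6⟩ := ptw_sign_left (fun t => - φ t) _ s (hd s).neg (by linarith)
  have h7 := h6 (max a (s - r/2)) (lt_max_of_lt_right (by linarith)) (max_lt h1 (by linarith))
  have h8 := h4 (max a (s - r/2)) (le_max_left _ _) (max_lt h1 (by linarith))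
  linarith

theorem ptw_pos (y y' : ℝ → ℝ) (a b K : ℝ) (hd : ∀ t, HasDerivAt y (y' t) t) (hab : a ≤ b)
    (h : ∀ t, a < t → t < b → -(K * y t) ≤ y' t) (h0 : 0 < y a) : 0 < y b := by
  have hde : ∀ t, HasDerivAt (fun t => Real.exp (K * t)) (Real.exp (K * t) * (K * 1)) t :=
    fun t => ((hasDerivAt_id t).const_mul K).exp
  have := ptw_lower (fun t => y t * Real.exp (K * t)) _ a b 0 (fun t => (hd t).mul (hde t)) hab
    (fun t h1 h2 => by
      have h3 := h t h1 h2
      have := Real.exp_pos (K * t)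
      nlinarith)
  simp only [zero_mul, add_zero] at this
  have h1 : 0 < y a * Real.exp (K * a) := by positivity
  exact pos_of_mul_pos_left (lt_of_lt_of_le h1 this) (Real.exp_pos _).le

theorem ptw_ind (y : ℝ → ℝ) (hy : Continuous y) (τ A B : ℝ) (hAB : A < B) (h0 : y 0 ≤ A)
    (h : ∀ s, 0 ≤ s → s ≤ τ → (∀ t, 0 ≤ t → t ≤ s → y t ≤ B) → y s ≤ A) :
    ∀ s, 0 ≤ s → s ≤ τ → y s ≤ A := by
  intro s hs0 hs
  apply h s hs0 hs
  by_contra hh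
  push Not at hh
  obtain ⟨t, h1, h2, h3⟩ := hh
  obtain ⟨r, hr1, hr2, hr3, hr4⟩ := ptw_first (fun t => y t - B) (by fun_prop) 0 t h1
    (by linarith) (by linarith)
  have := h r hr1.le (by linarith) (fun x hx hx' => by
    rcases lt_or_eq_of_le hx' with h | h
    · linarith [hr4 x hx h]
    · rw [h]; linarith)
  linarith

noncomputable def ptwTc (c e : ℝ) : ℝ := 256 * c / e ^ 2 + 8 / (c * e)

structure PLeg (c κ e δ : ℝ) (y q W P R : ℝ → ℝ) : Prop where
  hc : 0 < c
  hκ : 0 < κ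
  he : 0 < e
  he1 : e < 1
  hδ : 0 < δ
  s1 : 6 * δ ≤ c ^ 2
  s2 : 384 * δ ≤ e ^ 2
  s3 : 24 * δ ≤ e * c ^ 2
  s4 : 10 * κ * ptwTc c e < δ
  hy : ∀ t, HasDerivAt y (-(q t)) t
  hq : ∀ t, HasDerivAt q (P t) t
  hP : ∀ t, -3 ≤ y t → y t ≤ 5 → P t = -c * q t + (y t) ^ 2 * (3 - y t) - W t
  hW : ∀ t, HasDerivAt W (κ * R t) t
  hR1 : ∀ t, e - y t ≤ R t
  hR2 : ∀ t, R t ≤ 3 - y t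
  y0 : y 0 = 2
  q0 : 0 ≤ q 0
  W0a : -(3 / 2 * δ) ≤ W 0
  W0b : W 0 ≤ 3 / 2 * δ

namespace PLeg

variable {c κ e δ : ℝ} {y q W P R : ℝ → ℝ}

theorem cy (h : PLeg c κ e δ y q W P R) : Continuous y :=
  continuous_iff_continuousAt.mpr fun t => (h.hy t).continuousAt
theorem cq (h : PLeg c κ e δ y q W P R) : Continuous q :=
  continuous_iff_continuousAt.mpr fun t => (h.hq t).continuousAt
theorem cW (h : PLeg c κ e δ y q W P R) : Continuous W :=
  continuous_iff_continuousAt.mpr fun t => (h.hW t).continuousAt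

theorem Tc_pos (h : PLeg c κ e δ y q W P R) : 0 < ptwTc c e := by
  have := h.hc; have := h.he
  unfold ptwTc; positivity

theorem d1 (h : PLeg c κ e δ y q W P R) : 384 * δ < 1 := by
  have := h.s2; have := h.he; have := h.he1
  nlinarith

theorem front1 (h : PLeg c κ e δ y q W P R) (τ : ℝ)
    (hN : ∀ t, 0 ≤ t → t ≤ τ → -2 ≤ y t ∧ W t ≤ 3 * δ) :
    ∀ t, 0 ≤ t → t ≤ τ → y t ≤ 2 ∧ -(3 * δ) ≤ c * q t ∧
      c * y t - q t ≤ 2 * c - min (q 0) (c / 2) := by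
  have hc := h.hc
  have hδ := h.hδ
  have hd1 := h.d1
  have A : ∀ s, 0 ≤ s → s ≤ τ → (∀ t, 0 ≤ t → t ≤ s → y t ≤ 5 / 2) → -(3 * δ) ≤ c * q s := by
    intro s hs0 hs hb
    have := ptw_decay0 (fun t => -(3 * δ) - c * q t) (fun t => 0 - c * P t) 0 s
      (fun t => ((hasDerivAt_const t (-(3 * δ))).sub ((h.hq t).const_mul c))) hs0
      (fun t ht0 ht hp => by
        have h1 := hN t ht0 (ht.trans hs)
        have h2 := hb t ht0 ht
        have h3 := h.hP t (by linarith) (by linarith)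
        have h4 : 0 ≤ (y t) ^ 2 * (3 - y t) := mul_nonneg (sq_nonneg _) (by linarith)
        have h5 : 0 ≤ P t := by rw [h3]; nlinarith
        nlinarith)
      (by have := h.q0; nlinarith)
    linarith
  have B : ∀ s, 0 ≤ s → s ≤ τ → (∀ t, 0 ≤ t → t ≤ s → y t ≤ 5 / 2) →
      c * y s - q s ≤ 2 * c - min (q 0) (c / 2) := by
    intro s hs0 hs hb
    have := ptw_decay0 (fun t => c * y t - q t - (2 * c - min (q 0) (c / 2)))
      (fun t => c * (-(q t)) - P t) 0 s
      (fun t => (((h.hy t).const_mul c).sub (h.hq t)).sub_const _) hs0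
      (fun t ht0 ht hp => by
        have h1 := hN t ht0 (ht.trans hs)
        have h2 := hb t ht0 ht
        have h3 := h.hP t (by linarith) (by linarith)
        have h4 := A t ht0 (ht.trans hs) (fun x hx hx' => hb x hx (hx'.trans ht))
        have h5 : min (q 0) (c / 2) ≤ c / 2 := min_le_right _ _
        have h6 : 1 < y t := by
          by_contra hh
          have h7 : y t ≤ 1 := not_lt.mp hh
          have h8 : q t < - (c / 2) := by nlinarith
          have := h.s1
          nlinarith
        have h9 : 2 ≤ (y t) ^ 2 * (3 - y t) := by nlinarith [mul_nonneg (sub_nonneg.mpr h6.le) (sub_nonneg.mpr h2), mul_nonneg (mul_nonneg (sub_nonneg.mpr h6.le) (sub_nonneg.mpr h6.le)) (sub_nonneg.mpr h2)]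
        rw [h3]; linarith [h1.2])
      (by
        have := min_le_left (q 0) (c / 2)
        simp only [h.y0]; linarith)
    linarith
  have C : ∀ s, 0 ≤ s → s ≤ τ → y s ≤ 2 := by
    refine ptw_ind y h.cy τ 2 (5 / 2) (by norm_num) h.y0.le ?_
    intro s hs0 hs hb
    have := ptw_decay0 (fun t => y t - 2) (fun t => -(q t)) 0 s
      (fun t => (h.hy t).sub_const _) hs0
      (fun t ht0 ht hp => by
        have h1 := B t ht0 (ht.trans hs) (fun x hx hx' => hb x hx (hx'.trans ht))
        have h2 : 0 ≤ min (q 0) (c / 2) := le_min h.q0 (by linarith)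
        nlinarith)
      (by simp only [h.y0]; norm_num)
    linarith
  intro t ht0 ht
  refine ⟨C t ht0 ht, A t ht0 ht ?_, B t ht0 ht ?_⟩ <;>
  · intro s hs0 hs
    linarith [C s hs0 (hs.trans ht)]

theorem front_lt (h : PLeg c κ e δ y q W P R) (τ : ℝ)
    (hN : ∀ t, 0 ≤ t → t ≤ τ → -2 ≤ y t ∧ W t ≤ 3 * δ) (hq0 : 0 < q 0) :
    ∀ t, 0 < t → t ≤ τ → y t < 2 := by
  intro t ht0 ht
  have F := h.front1 τ hN
  rcases lt_or_eq_of_le (F t ht0.le ht).1 with h1 | h1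
  · exact h1
  exfalso
  have hc := h.hc
  have h2 := (F t ht0.le ht).2.2
  have h3 : 0 < min (q 0) (c / 2) := lt_min hq0 (by linarith)
  have h4 : 0 < q t := by rw [h1] at h2; linarith
  obtain ⟨r, hr, h5⟩ := ptw_sign_left (fun t => - y t) _ t (h.hy t).neg (by linarith)
  have h7 := h5 (max 0 (t - r/2)) (lt_max_of_lt_right (by linarith)) (max_lt ht0 (by linarith))
  have h8 := (F (max 0 (t - r/2)) (le_max_left _ _) (le_trans (max_lt ht0 (by linarith)).le ht)).1
  linarith

theorem front2 (h : PLeg c κ e δ y q W P R) (τ : ℝ)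
    (hN : ∀ t, 0 ≤ t → t ≤ τ → -2 ≤ y t ∧ W t ≤ 3 * δ) :
    ∀ t, ptwTc c e ≤ t → t ≤ τ → y t ≤ e / 2 := by
  have hc := h.hc
  have hδ := h.hδ
  have he := h.he
  have hd1 := h.d1
  have F := h.front1 τ hN
  have h2min : 0 ≤ min (q 0) (c / 2) := le_min h.q0 (by linarith)
  set T1 : ℝ := 256 * c / e ^ 2 with hT1
  have hT1p : 0 < T1 := by positivity
  have hT2p : 0 < 8 / (c * e) := by positivity
  have X : ∀ t, T1 ≤ t → t ≤ τ → c * y t - q t ≤ c * (e / 4) := by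
    intro t ht1 ht
    have := ptw_decay (fun t => c * y t - q t - c * (e / 4)) (fun t => c * (-(q t)) - P t) 0 t
      (e ^ 2 / 128) (fun t => (((h.hy t).const_mul c).sub (h.hq t)).sub_const _) (by linarith)
      (fun s hs0 hs hp => by
        have h1 := hN s hs0 (hs.trans ht)
        have h2 := F s hs0 (hs.trans ht)
        have h3 := h.hP s (by linarith) (by linarith)
        have h4 : e / 8 < y s := by
          by_contra hh
          have h5 : y s ≤ e / 8 := not_lt.mp hh
          have h6 : q s < - (c * e / 8) := by nlinarith
          have := h.s3
          nlinarith
        have h5 : e ^ 2 / 64 ≤ (y s) ^ 2 * (3 - y s) := by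
          have h6 : e ^ 2 / 64 ≤ (y s) ^ 2 := by nlinarith
          nlinarith [sq_nonneg (y s)]
        have := h.s2
        rw [h3]; linarith [h1.2]) (by positivity)
    simp only [h.y0] at this
    rcases this with h1 | h1
    · linarith
    · have h3 : 2 * c ≤ e ^ 2 / 128 * (t - 0) := by
        have : 2 * c = e ^ 2 / 128 * T1 := by rw [hT1]; field_simp; norm_num
        rw [this, sub_zero]; gcongr
      have := h.q0
      nlinarith
  intro t ht1 ht
  have hTc : ptwTc c e = T1 + 8 / (c * e) := rfl
  rw [hTc] at ht1
  have := ptw_decay (fun t => y t - e / 2) (fun t => -(q t)) T1 t (c * e / 4)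
    (fun t => (h.hy t).sub_const _) (by linarith)
    (fun s hs0 hs hp => by
      have h1 := X s hs0 (hs.trans ht)
      nlinarith) (by positivity)
  rcases this with h1 | h1
  · linarith
  · have h2 : 2 ≤ c * e / 4 * (t - T1) := by
      have : 2 = c * e / 4 * (8 / (c * e)) := by field_simp; norm_num
      rw [this]; gcongr; linarith
    have h3 := (F T1 hT1p.le (by linarith)).1
    linarith

theorem frontR (h : PLeg c κ e δ y q W P R) (t : ℝ) (h1 : -2 ≤ y t) (h2 : y t ≤ 2) :
    -2 ≤ R t ∧ R t ≤ 5 := by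
  have := h.hR1 t; have := h.hR2 t; have := h.he
  constructor <;> linarith

theorem front3 (h : PLeg c κ e δ y q W P R) (τ : ℝ)
    (hN : ∀ t, 0 ≤ t → t ≤ τ → -2 ≤ y t ∧ W t ≤ 3 * δ) :
    ∀ t, 0 ≤ t → t ≤ τ → W 0 - δ / 2 ≤ W t ∧ W t ≤ W 0 + 5 * κ * t ∧
      (t ≤ ptwTc c e → W t < W 0 + δ / 2) ∧
      W 0 - δ / 2 + κ * (e / 2) * (t - ptwTc c e) ≤ W t := by
  have F := h.front1 τ hN
  have F2 := h.front2 τ hN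
  have hκ := h.hκ
  have he := h.he
  have hs4 := h.s4
  have hTc := h.Tc_pos
  have up : ∀ t, 0 ≤ t → t ≤ τ → W t ≤ W 0 + 5 * κ * t := by
    intro t ht0 ht
    have := ptw_upper W _ 0 t (5 * κ) h.hW ht0 (fun s hs0 hs => by
      have := (h.frontR s (hN s hs0.le (by linarith)).1 (F s hs0.le (by linarith)).1).2
      nlinarith)
    linarith
  have lo : ∀ t, 0 ≤ t → t ≤ τ → W 0 - 5 * κ * t ≤ W t := by
    intro t ht0 ht
    have := ptw_lower W _ 0 t (-(5 * κ)) h.hW ht0 (fun s hs0 hs => by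
      have := (h.frontR s (hN s hs0.le (by linarith)).1 (F s hs0.le (by linarith)).1).1
      nlinarith)
    linarith
  have lo2 : ∀ t, ptwTc c e ≤ t → t ≤ τ → W 0 - δ / 2 + κ * (e / 2) * (t - ptwTc c e) ≤ W t := by
    intro t ht0 ht
    have := ptw_lower W _ (ptwTc c e) t (κ * (e / 2)) h.hW ht0 (fun s hs0 hs => by
      have h1 := h.hR1 s
      have h2 := F2 s hs0.le (by linarith)
      have : e / 2 ≤ R s := by linarith
      gcongr)
    have h3 := lo (ptwTc c e) hTc.le (by linarith)
    linarith
  intro t ht0 ht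
  refine ⟨?_, up t ht0 ht, ?_, ?_⟩
  · rcases le_total t (ptwTc c e) with h1 | h1
    · have h2 := lo t ht0 ht
      have h3 : κ * t ≤ κ * ptwTc c e := by gcongr
      linarith
    · have h2 := lo2 t h1 ht
      have h3 : 0 ≤ κ * (e / 2) * (t - ptwTc c e) := by
        apply mul_nonneg (by positivity); linarith
      linarith
  · intro h1
    have h2 := up t ht0 ht
    have h3 : κ * t ≤ κ * ptwTc c e := by gcongr
    linarith
  · rcases le_total t (ptwTc c e) with h1 | h1
    · have h2 := lo t ht0 ht
      have h3 : κ * t ≤ κ * ptwTc c e := by gcongr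
      have h4 : κ * (e / 2) * (t - ptwTc c e) ≤ 0 :=
        mul_nonpos_of_nonneg_of_nonpos (by positivity) (by linarith)
      linarith
    · exact lo2 t h1 ht

end PLeg

noncomputable def ptwE (δ y W : ℝ) : ℝ := max (-2 - y) (max (min y (W - 2 * δ)) (W - 4 - 2 * δ))

theorem ptwE_neg (δ y W : ℝ) :
    ptwE δ y W < 0 ↔ -2 < y ∧ (y < 0 ∨ W < 2 * δ) ∧ W < 4 + 2 * δ := by
  unfold ptwE
  rw [max_lt_iff, max_lt_iff, min_lt_iff]
  constructor
  · rintro ⟨h1, h2 | h2, h3⟩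
    · exact ⟨by linarith, Or.inl h2, by linarith⟩
    · exact ⟨by linarith, Or.inr (by linarith), by linarith⟩
  · rintro ⟨h1, h2 | h2, h3⟩
    · exact ⟨by linarith, Or.inl h2, by linarith⟩
    · exact ⟨by linarith, Or.inr (by linarith), by linarith⟩

theorem ptwE_nonpos (δ y W : ℝ) :
    ptwE δ y W ≤ 0 ↔ -2 ≤ y ∧ (y ≤ 0 ∨ W ≤ 2 * δ) ∧ W ≤ 4 + 2 * δ := by
  unfold ptwE
  rw [max_le_iff, max_le_iff, min_le_iff]
  constructor
  · rintro ⟨h1, h2 | h2, h3⟩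
    · exact ⟨by linarith, Or.inl h2, by linarith⟩
    · exact ⟨by linarith, Or.inr (by linarith), by linarith⟩
  · rintro ⟨h1, h2 | h2, h3⟩
    · exact ⟨by linarith, Or.inl h2, by linarith⟩
    · exact ⟨by linarith, Or.inr (by linarith), by linarith⟩

theorem ptw_le_end (f : ℝ → ℝ) (hf : Continuous f) (a b C : ℝ) (hab : a < b)
    (h : ∀ t, a ≤ t → t < b → f t ≤ C) : f b ≤ C := by
  have h1 : Filter.Tendsto f (nhdsWithin b (Set.Iio b)) (nhds (f b)) :=
    (hf.tendsto b).mono_left nhdsWithin_le_nhds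
  refine le_of_tendsto h1 ?_
  filter_upwards [Ioo_mem_nhdsLT hab] with t ht
  exact h t ht.1.le ht.2

noncomputable def ptwTm (c κ e δ : ℝ) : ℝ := ptwTc c e + 8 * δ / (κ * e) + 4 / (κ * e)

namespace PLeg

variable {c κ e δ : ℝ} {y q W P R : ℝ → ℝ}

theorem cE (h : PLeg c κ e δ y q W P R) : Continuous (fun t => ptwE δ (y t) (W t)) := by
  have := h.cy; have := h.cW
  unfold ptwE; fun_prop

theorem phase2 (h : PLeg c κ e δ y q W P R) (T t1 : ℝ)
    (hE : ∀ t, 0 ≤ t → t < T → ptwE δ (y t) (W t) < 0) (h1 : 0 ≤ t1) (h2 : t1 < T)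
    (h3 : W t1 = 2 * δ) :
    (∀ t, t1 ≤ t → t < T → y t < 0) ∧
    (∀ t, t1 ≤ t → t ≤ T → y t ≤ 0 ∧ 2 * δ + κ * e * (t - t1) ≤ W t) := by
  have hκ := h.hκ
  have he := h.he
  have hE' := fun t ht ht' => (ptwE_neg _ _ _).mp (hE t ht ht')
  have A : ∀ t, t1 ≤ t → t < T → 2 * δ ≤ W t := by
    intro t ht1 ht
    by_contra hh
    obtain ⟨s, hs1, hs2, hs3, hs4⟩ := ptw_last (fun t => 2 * δ - W t)
      (by have := h.cW; fun_prop) t1 t ht1 (by simp only [h3]; linarith) (by linarith)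
    have hE1 := hE' s (by linarith) (by linarith)
    have hys : y s < 0 := by
      rcases hE1.2.1 with h | h
      · exact h
      · linarith
    have hR : 0 < R s := by linarith [h.hR1 s]
    obtain ⟨r, hr, h5⟩ := ptw_sign_right W _ s (h.hW s) (by positivity)
    have h6 := h5 (min t (s + r/2)) (lt_min hs2 (by linarith))
      (lt_of_le_of_lt (min_le_right _ _) (by linarith))
    have h7 := hs4 (min t (s + r/2)) (lt_min hs2 (by linarith)) (min_le_left _ _)
    linarith
  have B : ∀ t, t1 ≤ t → t < T → y t < 0 := by
    intro t ht1 ht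
    rcases (hE' t (by linarith) ht).2.1 with h | h
    · exact h
    · linarith [A t ht1 ht]
  refine ⟨B, fun t ht1 ht => ⟨?_, ?_⟩⟩
  · rcases lt_or_eq_of_le ht with h4 | h4
    · exact (B t ht1 h4).le
    · rw [h4]
      exact ptw_le_end y h.cy t1 T 0 h2 (fun s hs hs' => (B s hs hs').le)
  · have := ptw_lower W _ t1 t (κ * e) h.hW ht1 (fun s hs0 hs => by
      have h1 := h.hR1 s
      have h2 := B s hs0.le (by linarith)
      have : e ≤ R s := by linarith
      gcongr)
    linarith

theorem hit (h : PLeg c κ e δ y q W P R)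
    (hE : ∀ t, 0 ≤ t → t ≤ ptwTc c e + 8 * δ / (κ * e) → ptwE δ (y t) (W t) < 0) :
    ∃ t1, 0 < t1 ∧ t1 ≤ ptwTc c e + 8 * δ / (κ * e) ∧ W t1 = 2 * δ ∧
      ∀ t, 0 ≤ t → t < t1 → W t < 2 * δ := by
  have hκ := h.hκ
  have he := h.he
  have hδ := h.hδ
  have hTc := h.Tc_pos
  have hp : 0 < 8 * δ / (κ * e) := by positivity
  have : ∃ t, 0 ≤ t ∧ t ≤ ptwTc c e + 8 * δ / (κ * e) ∧ 2 * δ ≤ W t := by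
    by_contra hh
    push Not at hh
    have h3 := (h.front3 (ptwTc c e + 8 * δ / (κ * e)) (fun t ht ht' =>
      ⟨((ptwE_neg _ _ _).mp (hE t ht ht')).1.le, by linarith [hh t ht ht']⟩)
      (ptwTc c e + 8 * δ / (κ * e)) (by linarith) le_rfl).2.2.2
    have h4 := hh (ptwTc c e + 8 * δ / (κ * e)) (by linarith) le_rfl
    have h5 : κ * (e / 2) * (ptwTc c e + 8 * δ / (κ * e) - ptwTc c e) = 4 * δ := by
      field_simp; ring
    rw [h5] at h3
    linarith [h.W0a]
  obtain ⟨t, ht0, ht, htW⟩ := this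
  obtain ⟨s, h1, h2, h3, h4⟩ := ptw_first (fun t => W t - 2 * δ) (by have := h.cW; fun_prop) 0 t ht0
    (by linarith [h.W0b]) (by linarith)
  exact ⟨s, h1, by linarith, by linarith, fun x hx hx' => by linarith [h4 x hx hx']⟩

theorem exit_exists (h : PLeg c κ e δ y q W P R) :
    ∃ T, 0 < T ∧ T ≤ ptwTm c κ e δ ∧ ptwE δ (y T) (W T) = 0 ∧
      ∀ t, 0 ≤ t → t < T → ptwE δ (y t) (W t) < 0 := by
  have hκ := h.hκ
  have he := h.he
  have hδ := h.hδ
  have hTc := h.Tc_pos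
  have hp : 0 < 8 * δ / (κ * e) := by positivity
  have hp' : 0 < 4 / (κ * e) := by positivity
  have hTm : ptwTm c κ e δ = ptwTc c e + 8 * δ / (κ * e) + 4 / (κ * e) := rfl
  have : ∃ t, 0 ≤ t ∧ t ≤ ptwTm c κ e δ ∧ 0 ≤ ptwE δ (y t) (W t) := by
    by_contra hh
    push Not at hh
    obtain ⟨t1, h1, h2, h3, h4⟩ := h.hit (fun t ht ht' => hh t ht (by linarith))
    have h5 := ((h.phase2 (ptwTm c κ e δ) t1 (fun t ht ht' => hh t ht ht'.le) h1.le (by linarith)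
      h3).2 (ptwTm c κ e δ) (by linarith) le_rfl).2
    have h6 := ((ptwE_neg _ _ _).mp (hh (ptwTm c κ e δ) (by linarith) le_rfl)).2.2
    have h7 : κ * e * (4 / (κ * e)) ≤ κ * e * (ptwTm c κ e δ - t1) := by
      gcongr; linarith
    have h8 : κ * e * (4 / (κ * e)) = 4 := by field_simp
    linarith
  obtain ⟨t, ht0, ht, htW⟩ := this
  obtain ⟨s, h1, h2, h3, h4⟩ := ptw_first _ h.cE 0 t ht0
    (by
      rw [ptwE_neg, h.y0]
      refine ⟨by norm_num, Or.inr (by linarith [h.W0b]), by linarith [h.W0b]⟩) htW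
  exact ⟨s, h1, by linarith, h3, h4⟩

theorem nonpos_on (_h : PLeg c κ e δ y q W P R) {T : ℝ} (hz : ptwE δ (y T) (W T) = 0)
    (hE : ∀ t, 0 ≤ t → t < T → ptwE δ (y t) (W t) < 0) :
    ∀ t, 0 ≤ t → t ≤ T → -2 ≤ y t ∧ (y t ≤ 0 ∨ W t ≤ 2 * δ) ∧ W t ≤ 4 + 2 * δ := by
  intro t ht0 ht
  rw [← ptwE_nonpos]
  rcases lt_or_eq_of_le ht with h1 | h1
  · exact (hE t ht0 h1).le
  · rw [h1, hz]

theorem split (h : PLeg c κ e δ y q W P R) {T : ℝ} (hT : 0 < T)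
    (hz : ptwE δ (y T) (W T) = 0)
    (hE : ∀ t, 0 ≤ t → t < T → ptwE δ (y t) (W t) < 0) :
    (∀ t, 0 ≤ t → t ≤ T → W t ≤ 2 * δ) ∨
    (∃ t1, 0 < t1 ∧ t1 < T ∧ t1 ≤ ptwTc c e + 8 * δ / (κ * e) ∧ W t1 = 2 * δ ∧
      (∀ t, 0 ≤ t → t ≤ t1 → W t ≤ 2 * δ) ∧ (∀ t, t1 ≤ t → t < T → y t < 0) ∧
      (∀ t, t1 ≤ t → t ≤ T → y t ≤ 0 ∧ 2 * δ + κ * e * (t - t1) ≤ W t)) := by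
  by_cases hx : ∃ t, 0 ≤ t ∧ t < T ∧ 2 * δ ≤ W t
  · right
    obtain ⟨t, ht0, ht, htW⟩ := hx
    obtain ⟨s, h1, h2, h3, h4⟩ := ptw_first (fun t => W t - 2 * δ) (by have := h.cW; fun_prop) 0 t
      ht0 (by linarith [h.W0b, h.hδ]) (by linarith)
    have h5 := h.phase2 T s hE h1.le (by linarith) (by linarith)
    refine ⟨s, h1, by linarith, ?_, by linarith, ?_, h5.1, h5.2⟩
    · by_contra hh
      obtain ⟨t1, g1, g2, g3, g4⟩ := h.hit (fun t ht ht' => hE t ht (by linarith))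
      have := h4 t1 g1.le (by linarith)
      linarith
    · intro x hx hx'
      rcases lt_or_eq_of_le hx' with h6 | h6
      · linarith [h4 x hx h6]
      · rw [h6]; linarith
  · left
    push Not at hx
    intro t ht0 ht
    rcases lt_or_eq_of_le ht with h1 | h1
    · exact (hx t ht0 h1).le
    · rw [h1]
      exact ptw_le_end W h.cW 0 T _ hT (fun s hs hs' => (hx s hs hs').le)

theorem bounds (h : PLeg c κ e δ y q W P R) {T : ℝ} (hT : 0 < T)
    (hz : ptwE δ (y T) (W T) = 0)
    (hE : ∀ t, 0 ≤ t → t < T → ptwE δ (y t) (W t) < 0) :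
    ∀ t, 0 ≤ t → t ≤ T → -2 ≤ y t ∧ y t ≤ 2 ∧ -(2 * δ) ≤ W t ∧ W t ≤ 4 + 2 * δ := by
  have N := h.nonpos_on hz hE
  have hδ := h.hδ
  have hW0 := h.W0a
  intro t ht0 ht
  have n1 := N t ht0 ht
  rcases h.split hT hz hE with hs | ⟨t1, a1, a2, a3, a4, a5, a6, a7⟩
  · have hN : ∀ t, 0 ≤ t → t ≤ T → -2 ≤ y t ∧ W t ≤ 3 * δ := fun t ht ht' =>
      ⟨(N t ht ht').1, by linarith [hs t ht ht']⟩
    have f1 := h.front1 T hN t ht0 ht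
    have f3 := h.front3 T hN t ht0 ht
    exact ⟨n1.1, f1.1, by linarith [f3.1], n1.2.2⟩
  · rcases le_total t t1 with h1 | h1
    · have hN : ∀ t, 0 ≤ t → t ≤ t1 → -2 ≤ y t ∧ W t ≤ 3 * δ := fun t ht ht' =>
        ⟨(N t ht (by linarith)).1, by linarith [a5 t ht ht']⟩
      have f1 := h.front1 t1 hN t ht0 h1
      have f3 := h.front3 t1 hN t ht0 h1
      exact ⟨n1.1, f1.1, by linarith [f3.1], n1.2.2⟩
    · have := a7 t h1 ht
      have h3 : 0 ≤ κ * e * (t - t1) := by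
        have := h.hκ; have := h.he
        apply mul_nonneg (by positivity); linarith
      exact ⟨n1.1, by linarith, by linarith, n1.2.2⟩

theorem lt_two (h : PLeg c κ e δ y q W P R) {T : ℝ} (hT : 0 < T)
    (hz : ptwE δ (y T) (W T) = 0)
    (hE : ∀ t, 0 ≤ t → t < T → ptwE δ (y t) (W t) < 0) (hq0 : 0 < q 0) :
    ∀ t, 0 < t → t ≤ T → y t < 2 := by
  have N := h.nonpos_on hz hE
  have hδ := h.hδ
  intro t ht0 ht
  rcases h.split hT hz hE with hs | ⟨t1, a1, a2, a3, a4, a5, a6, a7⟩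
  · exact h.front_lt T (fun t ht ht' =>
      ⟨(N t ht ht').1, by linarith [hs t ht ht']⟩) hq0 t ht0 ht
  · rcases le_total t t1 with h1 | h1
    · exact h.front_lt t1 (fun t ht ht' =>
        ⟨(N t ht (by linarith)).1, by linarith [a5 t ht ht']⟩) hq0 t ht0 h1
    · linarith [(a7 t h1 ht).1]

theorem qbound (h : PLeg c κ e δ y q W P R) {T Q : ℝ} (hT : 0 < T)
    (hz : ptwE δ (y T) (W T) = 0)
    (hE : ∀ t, 0 ≤ t → t < T → ptwE δ (y t) (W t) < 0) (hQ1 : q 0 ≤ Q) (hQ2 : 21 ≤ c * Q) :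
    ∀ t, 0 ≤ t → t ≤ T → -Q ≤ q t ∧ q t ≤ Q := by
  have N := h.bounds hT hz hE
  have hδ := h.hδ
  have hc := h.hc
  have hd1 := h.d1
  have hq0 := h.q0
  have hg : ∀ t, 0 ≤ t → t ≤ T → 0 ≤ (y t) ^ 2 * (3 - y t) ∧ (y t) ^ 2 * (3 - y t) ≤ 20 := by
    intro t ht ht'
    have n := N t ht ht'
    have h4 : (y t) ^ 2 ≤ 4 := by nlinarith [n.1, n.2.1]
    constructor
    · exact mul_nonneg (sq_nonneg _) (by linarith)
    · have : (y t) ^ 2 * (3 - y t) ≤ 4 * 5 := by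
        apply mul_le_mul h4 (by linarith) (by linarith) (by norm_num)
      linarith
  intro t ht0 ht
  constructor
  · have := ptw_decay0 (fun t => -(q t) - Q) (fun t => -(P t)) 0 t
      (fun t => (h.hq t).neg.sub_const _) ht0
      (fun s hs0 hs hp => by
        have n := N s hs0 (hs.trans ht)
        have g := hg s hs0 (hs.trans ht)
        have h3 := h.hP s (by linarith) (by linarith)
        rw [h3]; nlinarith)
      (by linarith)
    linarith
  · have := ptw_decay0 (fun t => q t - Q) P 0 t
      (fun t => (h.hq t).sub_const _) ht0
      (fun s hs0 hs hp => by
        have n := N s hs0 (hs.trans ht)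
        have g := hg s hs0 (hs.trans ht)
        have h3 := h.hP s (by linarith) (by linarith)
        rw [h3]; nlinarith)
      (by linarith)
    linarith

end PLeg

structure PBar (c δ β η : ℝ) : Prop where
  hβ : 0 < β
  hβ2 : 2 * β ^ 2 = 1
  hη : 0 < η
  hm : β * (3 + 2 * η) < c
  sη : 2 * δ ≤ η

namespace PLeg

variable {c κ e δ : ℝ} {y q W P R : ℝ → ℝ}

theorem caseB (h : PLeg c κ e δ y q W P R) {T : ℝ} (hT : 0 < T)
    (hz : ptwE δ (y T) (W T) = 0)
    (hE : ∀ t, 0 ≤ t → t < T → ptwE δ (y t) (W t) < 0)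
    (s5 : 10 * κ * (1 / c + 16 * c / δ) < δ) (hW0 : W 0 ≤ -δ) : y T = -2 := by
  have N := h.nonpos_on hz hE
  have hδ := h.hδ
  have hc := h.hc
  have hκ := h.hκ
  set ts := 1 / c + 16 * c / δ with hts
  have p1 : 0 < 1 / c := by positivity
  have p2 : 0 < 16 * c / δ := by positivity
  have hWm : ∀ s, 0 ≤ s → s ≤ min T ts → W s ≤ -(δ / 2) := by
    refine ptw_ind W h.cW (min T ts) (-(δ / 2)) (3 * δ) (by linarith) (by linarith) ?_
    intro s hs0 hs hb
    have hsT : s ≤ T := hs.trans (min_le_left _ _)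
    have hst : s ≤ ts := hs.trans (min_le_right _ _)
    have f3 := (h.front3 s (fun t ht ht' => ⟨(N t ht (by linarith)).1, hb t ht ht'⟩) s hs0 le_rfl).2.1
    have : κ * s ≤ κ * ts := by gcongr
    linarith
  have hle : T ≤ ts := by
    by_contra hh
    have hh' : ts < T := not_le.mp hh
    rw [min_eq_right hh'.le] at hWm
    have F := h.front1 ts (fun t ht ht' => ⟨(N t ht (by linarith)).1, by linarith [hWm t ht ht']⟩)
    have hq : ∀ t, 1 / c ≤ t → t ≤ ts → δ / (4 * c) ≤ q t := by
      intro t ht1 ht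
      have := ptw_decay (fun t => δ / (4 * c) - q t) (fun t => 0 - P t) 0 t (δ / 4)
        (fun t => (hasDerivAt_const t _).sub (h.hq t)) (by linarith)
        (fun s hs0 hs hp => by
          have n := N s hs0 (by linarith)
          have f := F s hs0 (by linarith)
          have w := hWm s hs0 (by linarith)
          have h3 := h.hP s (by linarith) (by linarith)
          have h4 : 0 ≤ (y s) ^ 2 * (3 - y s) := mul_nonneg (sq_nonneg _) (by linarith)
          have h5 : c * q s ≤ δ / 4 := by
            have : c * q s ≤ c * (δ / (4 * c)) := by gcongr; linarith
            have e1 : c * (δ / (4 * c)) = δ / 4 := by field_simp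
            linarith
          rw [h3]; linarith) (by positivity)
      rcases this with h1 | h1
      · linarith
      · have h2 : δ / 4 * (1 / c) ≤ δ / 4 * (t - 0) := by gcongr; linarith
        have e1 : δ / 4 * (1 / c) = δ / (4 * c) := by field_simp
        have := h.q0
        linarith
    have hy := ptw_upper y _ (1 / c) ts (-(δ / (4 * c))) h.hy (by linarith)
      (fun t h1 h2 => by linarith [hq t h1.le h2.le])
    have e2 : -(δ / (4 * c)) * (ts - 1 / c) = -4 := by
      rw [hts]; field_simp; ring
    have h1 := (F (1 / c) p1.le (by linarith)).1
    have h2 := ((ptwE_neg _ _ _).mp (hE ts (by linarith) hh')).1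
    linarith
  rw [min_eq_left hle] at hWm
  have w := hWm T hT.le le_rfl
  by_contra hne
  have n := N T hT.le le_rfl
  have : ptwE δ (y T) (W T) < 0 := by
    rw [ptwE_neg]
    exact ⟨lt_of_le_of_ne n.1 (Ne.symm hne), Or.inr (by linarith), by linarith⟩
  linarith

theorem d1der (h : PLeg c κ e δ y q W P R) (β η : ℝ) (t : ℝ) :
    HasDerivAt (fun t => q t - β * (y t * (3 + 2 * η - y t)))
      (P t - β * (-(q t) * (3 + 2 * η - y t) + y t * (-(-(q t))))) t := by
  exact (h.hq t).sub (((h.hy t).mul ((h.hy t).const_sub _)).const_mul β)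

theorem d1ineq (h : PLeg c κ e δ y q W P R) {β η : ℝ} (b : PBar c δ β η) (t : ℝ)
    (h0 : 0 ≤ y t) (h2 : y t ≤ 2) (hD : 0 ≤ q t - β * (y t * (3 + 2 * η - y t))) :
    P t - β * (-(q t) * (3 + 2 * η - y t) + y t * (-(-(q t)))) ≤ - W t := by
  rw [h.hP t (by linarith) (by linarith)]
  obtain ⟨hβ, hβ2, hη, hm, -⟩ := b
  have h3 : 0 ≤ y t * (3 + 2 * η - y t) := mul_nonneg h0 (by linarith)
  have hq : 0 ≤ q t := by nlinarith
  have h4 : 0 ≤ (c - β * (3 + 2 * η)) * q t := mul_nonneg (by linarith) hq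
  have h5 : 0 ≤ (2 * β * y t) * (q t - β * (y t * (3 + 2 * η - y t))) :=
    mul_nonneg (by positivity) hD
  have h6 : (2 * β * y t) * (β * (y t * (3 + 2 * η - y t))) = (y t)^2 * (3 + 2 * η - y t) := by
    calc _ = (2 * β ^ 2) * ((y t)^2 * (3 + 2 * η - y t)) := by ring
      _ = _ := by rw [hβ2, one_mul]
  have h7 : 0 ≤ (y t)^2 * (2 * η) := by positivity
  nlinarith

theorem d1pos (h : PLeg c κ e δ y q W P R) {β η : ℝ} (b : PBar c δ β η) (a s : ℝ) (has : a ≤ s)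
    (h0 : ∀ t, a ≤ t → t ≤ s → 0 ≤ y t ∧ y t ≤ 2 ∧ 0 ≤ W t)
    (hD : q a - β * (y a * (3 + 2 * η - y a)) ≤ 0) :
    ∀ t, a ≤ t → t ≤ s → q t - β * (y t * (3 + 2 * η - y t)) ≤ 0 := by
  intro t ht ht'
  exact ptw_decay0 _ _ a t (fun t => h.d1der β η t) ht
    (fun x hx hx' hp => by
      have n := h0 x hx (hx'.trans ht')
      linarith [h.d1ineq b x n.1 n.2.1 hp.le]) hD

theorem ypos (h : PLeg c κ e δ y q W P R) {β η : ℝ} (b : PBar c δ β η) (a s : ℝ) (has : a ≤ s)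
    (h0 : ∀ t, a ≤ t → t ≤ s → 0 ≤ y t ∧ y t ≤ 2 ∧ 0 ≤ W t) (hya : 0 < y a)
    (hD : q a - β * (y a * (3 + 2 * η - y a)) ≤ 0) : 0 < y s := by
  have D := h.d1pos b a s has h0 hD
  refine ptw_pos y _ a s (β * (3 + 2 * η)) h.hy has (fun t h1 h2 => ?_) hya
  have n := h0 t h1.le h2.le
  have d := D t h1.le h2.le
  have : 0 ≤ β * (y t * y t) := mul_nonneg b.hβ.le (mul_nonneg n.1 n.1)
  nlinarith

theorem caseC (h : PLeg c κ e δ y q W P R) {T : ℝ} (hT : 0 < T)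
    (hz : ptwE δ (y T) (W T) = 0)
    (hE : ∀ t, 0 ≤ t → t < T → ptwE δ (y t) (W t) < 0) {β η : ℝ} (b : PBar c δ β η)
    (hq0 : q 0 ≤ 2 * β * (1 + η)) (hW0 : δ ≤ W 0) : W T = 2 * δ ∧ 0 < y T := by
  have N := h.nonpos_on hz hE
  have B := h.bounds hT hz hE
  have hδ := h.hδ
  have key : ∀ τ, 0 ≤ τ → τ ≤ T → (∀ t, 0 ≤ t → t ≤ τ → W t ≤ 2 * δ) → 0 < y τ := by
    intro τ hτ0 hτ hw
    by_contra hh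
    obtain ⟨s, h1, h2, h3, h4⟩ := ptw_first (fun t => - y t) (by have := h.cy; fun_prop) 0 τ hτ0
      (by simp only [h.y0]; norm_num) (by linarith)
    have F := h.front3 s (fun t ht ht' => ⟨(N t ht (by linarith)).1,
      by linarith [hw t ht (by linarith)]⟩)
    have : 0 < y s := by
      refine h.ypos b 0 s h1.le (fun t ht ht' => ⟨?_, (B t ht (by linarith)).2.1, ?_⟩) (by rw [h.y0]; norm_num) ?_
      · rcases lt_or_eq_of_le ht' with h5 | h5
        · linarith [h4 t ht h5]
        · rw [h5]; linarith
      · linarith [(F t ht ht').1]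
      · rw [h.y0]
        have : 0 < β * η := mul_pos b.hβ b.hη
        linarith
    linarith
  rcases h.split hT hz hE with hs | ⟨t1, a1, a2, a3, a4, a5, a6, a7⟩
  · have h1 := key T hT.le le_rfl hs
    refine ⟨?_, h1⟩
    by_contra hne
    have h2 := lt_of_le_of_ne (hs T hT.le le_rfl) hne
    have : ptwE δ (y T) (W T) < 0 := by
      rw [ptwE_neg]
      exact ⟨by linarith, Or.inr h2, by linarith⟩
    linarith
  · have h1 := key t1 a1.le a2.le a5
    linarith [a6 t1 le_rfl a2]

theorem above_left (h : PLeg c κ e δ y q W P R) {T : ℝ} (hyT : y T = 0) (hW : 0 < W T)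
    (hq : 0 ≤ q T) : ∃ r > 0, ∀ t, T - r < t → t < T → 0 < y t := by
  rcases lt_or_eq_of_le hq with h1 | h1
  · obtain ⟨r, hr, h2⟩ := ptw_sign_left (fun t => - y t) _ T (h.hy T).neg (by linarith)
    refine ⟨r, hr, fun t ht ht' => ?_⟩
    have := h2 t ht ht'
    linarith
  · have hP := h.hP T (by rw [hyT]; norm_num) (by rw [hyT]; norm_num)
    rw [hyT, ← h1] at hP
    obtain ⟨r, hr, h2⟩ := ptw_sign_left (fun t => - q t) _ T (h.hq T).neg (by linarith)
    refine ⟨r, hr, fun t ht ht' => ?_⟩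
    by_contra hh
    have hmono : StrictAntiOn y (Set.Icc t T) := by
      apply strictAntiOn_of_deriv_neg (convex_Icc _ _) h.cy.continuousOn
      intro x hx
      rw [interior_Icc] at hx
      rw [(h.hy x).deriv]
      have := h2 x (by linarith [hx.1]) hx.2
      linarith
    have := hmono ⟨le_rfl, ht'.le⟩ ⟨ht'.le, le_rfl⟩ ht'
    linarith

theorem corner (h : PLeg c κ e δ y q W P R) {T Q : ℝ} (hT : 0 < T)
    (hz : ptwE δ (y T) (W T) = 0)
    (hE : ∀ t, 0 ≤ t → t < T → ptwE δ (y t) (W t) < 0) {β η : ℝ} (b : PBar c δ β η)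
    (hQ1 : q 0 ≤ Q) (hQ2 : 21 ≤ c * Q) (s6 : 10 * κ * Q < δ ^ 2)
    (hs : ∀ t, 0 ≤ t → t ≤ T → W t ≤ 2 * δ) (hyT : y T = 0) (hWT : W T = 2 * δ) : q T < 0 := by
  have N := h.nonpos_on hz hE
  have B := h.bounds hT hz hE
  have QB := h.qbound hT hz hE hQ1 hQ2
  have hδ := h.hδ
  have hκ := h.hκ
  by_contra hh
  obtain ⟨r, hr, hy⟩ := h.above_left hyT (by linarith) (not_lt.mp hh)
  have F := h.front3 T (fun t ht ht' => ⟨(N t ht ht').1, by linarith [hs t ht ht']⟩)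
  set s0 := T - δ / (10 * κ) with hs0
  have hk : 0 < δ / (10 * κ) := by positivity
  have hs0p : 0 ≤ s0 := by
    have h1 := (F T hT.le le_rfl).2.1
    have h2 : δ / 2 ≤ 5 * κ * T := by linarith [h.W0b]
    have : δ / (10 * κ) ≤ T := by
      rw [div_le_iff₀ (by positivity)]; linarith
    linarith
  have hWd : ∀ t, s0 ≤ t → t ≤ T → δ ≤ W t := by
    intro t ht ht'
    have := ptw_upper W _ t T (5 * κ) h.hW ht' (fun s h1 h2 => by
      have n := B s (by linarith) h2.le
      have := (h.frontR s n.1 n.2.1).2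
      nlinarith)
    have h3 : 5 * κ * (T - t) ≤ 5 * κ * (δ / (10 * κ)) := by gcongr; linarith
    have e1 : 5 * κ * (δ / (10 * κ)) = δ / 2 := by field_simp; norm_num
    linarith
  -- upper end
  have hW0 : ∀ t, s0 ≤ t → t ≤ T → 0 ≤ W t := fun t h1 h2 => by linarith [hWd t h1 h2]
  have fin : ∀ a, s0 ≤ a → a < T → (∀ t, a < t → t < T → 0 < y t) → 0 ≤ y a →
      q a - β * (y a * (3 + 2 * η - y a)) ≤ 0 → False := by
    intro a ha haT hp hya hD
    have h0 : ∀ t, a ≤ t → t ≤ T → 0 ≤ y t ∧ y t ≤ 2 ∧ 0 ≤ W t := by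
      intro t ht ht'
      refine ⟨?_, (B t (by linarith) ht').2.1, hW0 t (by linarith) ht'⟩
      rcases eq_or_lt_of_le ht with h1 | h1
      · rw [← h1]; exact hya
      · rcases eq_or_lt_of_le ht' with h2 | h2
        · rw [h2, hyT]
        · exact (hp t h1 h2).le
    have D := h.d1pos b a T haT.le h0 hD
    have hm : a < (a + T) / 2 ∧ (a + T) / 2 < T := by constructor <;> linarith
    have := h.ypos b ((a + T) / 2) T hm.2.le (fun t ht ht' => h0 t (by linarith) ht')
      (hp _ hm.1 hm.2) (D _ hm.1.le hm.2.le)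
    linarith
  by_cases hx : ∃ t, s0 ≤ t ∧ t < T ∧ y t ≤ 0
  · obtain ⟨t, ht0, ht, hty⟩ := hx
    have htr : t ≤ T - r := by
      by_contra hc
      linarith [hy t (by linarith) ht]
    obtain ⟨a, h1, h2, h3, h4⟩ := ptw_last y h.cy t (T - r / 2) (by linarith) hty
      (hy _ (by linarith) (by linarith))
    have hpos : ∀ x, a < x → x < T → 0 < y x := by
      intro x hx hx'
      rcases le_or_gt x (T - r / 2) with h5 | h5
      · exact h4 x hx h5
      · exact hy x (by linarith) hx'
    have hqa : q a ≤ 0 := by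
      by_contra hqa
      obtain ⟨r', hr', h5⟩ := ptw_sign_right (fun t => - y t) _ a (h.hy a).neg (by linarith)
      have h6 := h5 (min (T - r / 2) (a + r' / 2)) (lt_min h2 (by linarith))
        (lt_of_le_of_lt (min_le_right _ _) (by linarith))
      have h7 := h4 (min (T - r / 2) (a + r' / 2)) (lt_min h2 (by linarith)) (min_le_left _ _)
      linarith
    exact fin a (by linarith) (by linarith) hpos h3.ge (by rw [h3]; linarith)
  · push Not at hx
    have hsT : s0 < T := by linarith
    have ht1 : ∃ t1, s0 ≤ t1 ∧ t1 < T ∧ q t1 - β * (y t1 * (3 + 2 * η - y t1)) ≤ 0 := by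
      by_contra hcon
      push Not at hcon
      set tm := s0 + Q / δ with htm
      have hQ0 : 0 ≤ Q := h.q0.trans hQ1
      have hQd : 0 ≤ Q / δ := by positivity
      have htmT : tm < T := by
        have : Q / δ < δ / (10 * κ) := by
          rw [div_lt_div_iff₀ hδ (by positivity)]; nlinarith
        linarith
      have := ptw_upper _ _ s0 tm (-δ) (fun t => h.d1der β η t) (by linarith)
        (fun t g1 g2 => by
          have g3 := hx t g1.le (by linarith)
          have g4 := hcon t g1.le (by linarith)
          have g5 := h.d1ineq b t g3.le (B t (by linarith) (by linarith)).2.1 g4.le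
          linarith [hWd t g1.le (by linarith)])
      have g1 := hcon tm (by linarith) htmT
      have g2 := (QB s0 hs0p (by linarith)).2
      have g3 := hx s0 le_rfl hsT
      have g4 := (B s0 hs0p (by linarith)).2.1
      have g5 : 0 ≤ β * (y s0 * (3 + 2 * η - y s0)) :=
        mul_nonneg b.hβ.le (mul_nonneg g3.le (by linarith [b.hη]))
      have g6 : -δ * (tm - s0) = -Q := by rw [htm]; field_simp; ring
      linarith
    obtain ⟨t1, g1, g2, g3⟩ := ht1
    exact fin t1 g1 g2 (fun t i1 i2 => hx t (by linarith) i2) (hx t1 g1 g2).le g3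

theorem exit_up (h : PLeg c κ e δ y q W P R) {T t1 : ℝ} (ht : t1 < T)
    (hy : ∀ t, t1 ≤ t → t < T → y t < 0) (hyT : y T = 0) (hW : 0 < W T) : q T < 0 := by
  by_contra hh
  obtain ⟨r, hr, h1⟩ := h.above_left hyT hW (not_lt.mp hh)
  have h2 := h1 (max t1 (T - r/2)) (lt_max_of_lt_right (by linarith)) (max_lt ht (by linarith))
  have h3 := hy (max t1 (T - r/2)) (le_max_left _ _) (max_lt ht (by linarith))
  linarith

theorem caseE (h : PLeg c κ e δ y q W P R) {T : ℝ} (hT : 0 < T)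
    (hz : ptwE δ (y T) (W T) = 0)
    (hE : ∀ t, 0 ≤ t → t < T → ptwE δ (y t) (W t) < 0) {β η : ℝ} (b : PBar c δ β η)
    (hyT : y T = 0) (hq : q T < 0) : -(2 * β * (1 + η)) < q T := by
  have B := h.bounds hT hz hE
  have hδ := h.hδ
  obtain ⟨hβ, hβ2, hη, hm, hsη⟩ := b
  obtain ⟨s, h1, h2, h3, h4⟩ := ptw_last (fun t => - q t) (by have := h.cq; fun_prop) 0 T hT.le
    (by linarith [h.q0]) (by linarith)
  have hyneg : ∀ t, s ≤ t → t ≤ T → y t ≤ 0 := by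
    intro t ht ht'
    have := ptw_lower y _ t T 0 h.hy ht' (fun x hx hx' => (h4 x (by linarith) hx'.le).le)
    linarith
  have hPs : P s ≤ 0 := by
    by_contra hP
    obtain ⟨r', hr', h5⟩ := ptw_sign_right q _ s (h.hq s) (not_le.mp hP)
    have h6 := h5 (min T (s + r' / 2)) (lt_min h2 (by linarith))
      (lt_of_le_of_lt (min_le_right _ _) (by linarith))
    have h7 := h4 (min T (s + r' / 2)) (lt_min h2 (by linarith)) (min_le_left _ _)
    linarith
  have bs := B s h1 h2.le
  have hys : -1 - η < y s := by
    by_contra hc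
    have hc' : y s ≤ -1 - η := not_lt.mp hc
    rw [h.hP s (by linarith) (by linarith)] at hPs
    have hqs : q s = 0 := by linarith
    rw [hqs] at hPs
    have g1 : (1 + η) ^ 2 ≤ (y s) ^ 2 := by nlinarith
    have g2 : (1 + η) ^ 2 * (4 + η) ≤ (y s) ^ 2 * (3 - y s) := by
      apply mul_le_mul g1 (by linarith) (by linarith) (sq_nonneg _)
    nlinarith [mul_pos hη hη, mul_pos (mul_pos hη hη) hη]
  have := ptw_strict (fun t => -(q t) - β * ((y t + 1 + η) * (2 - y t)))
    (fun t => -(P t) - β * ((-(q t)) * (2 - y t) + (y t + 1 + η) * (-(-(q t))))) s T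
    (fun t => (h.hq t).neg.sub (((((h.hy t).add_const 1).add_const η).mul
      ((h.hy t).const_sub 2)).const_mul β)) h2.le
    (fun t ht ht' h0 => by
      have bt := B t (by linarith) ht'
      have hyt := hyneg t ht ht'
      rw [h.hP t (by linarith) (by linarith)]
      have hv : -(q t) = β * ((y t + 1 + η) * (2 - y t)) := by linarith
      have hmono := ptw_lower y _ s t 0 h.hy ht (fun x hx hx' => (h4 x (by linarith) (by linarith)).le)
      have hA : 0 < y t + 1 + η := by linarith
      have hvpos : 0 < -(q t) := by rw [hv]; apply mul_pos hβ; apply mul_pos hA; linarith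
      have hk : 0 < (c - β * (3 + 2 * η)) * (-(q t)) := mul_pos (by linarith) hvpos
      have hqq : 2 * β * (-(q t)) = (y t + 1 + η) * (2 - y t) := by
        rw [hv]
        calc _ = (2 * β ^ 2) * ((y t + 1 + η) * (2 - y t)) := by ring
          _ = _ := by rw [hβ2, one_mul]
      have e1 : β * (4 + η - 2 * y t) * (-(q t)) = (2 + η / 2 - y t) * ((y t + 1 + η) * (2 - y t)) := by
        rw [← hqq]; ring
      have e2 : 0 ≤ (η / 2) * ((y t + 1 + η) * (2 - y t)) := by
        apply mul_nonneg (by linarith); apply mul_nonneg hA.le; linarith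
      have e3 : 4 * η ≤ η * (2 - y t) ^ 2 := by
        have : 4 ≤ (2 - y t) ^ 2 := by nlinarith
        nlinarith
      nlinarith)
    (by
      have hqs : q s = 0 := by linarith
      simp only [hqs]
      have : 0 < β * ((y s + 1 + η) * (2 - y s)) :=
        mul_pos hβ (mul_pos (by linarith) (by linarith [hyneg s le_rfl h2.le]))
      linarith)
  simp only [hyT] at this
  linarith

end PLeg

theorem ptwE_pos (δ y W : ℝ) :
    0 < ptwE δ y W ↔ y < -2 ∨ (0 < y ∧ 2 * δ < W) ∨ 4 + 2 * δ < W := by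
  unfold ptwE
  rw [lt_max_iff, lt_max_iff, lt_min_iff]
  constructor
  · rintro (h1 | h2 | h3)
    · exact Or.inl (by linarith)
    · exact Or.inr (Or.inl ⟨h2.1, by linarith [h2.2]⟩)
    · exact Or.inr (Or.inr (by linarith))
  · rintro (h1 | h2 | h3)
    · exact Or.inl (by linarith)
    · exact Or.inr (Or.inl ⟨h2.1, by linarith [h2.2]⟩)
    · exact Or.inr (Or.inr (by linarith))

theorem ptw_cont_right (f : ℝ → ℝ) (hf : Continuous f) (s C : ℝ) (h : C < f s) :
    ∃ r > 0, ∀ t, s < t → t < s + r → C < f t := by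
  have := (hf.tendsto s).eventually (lt_mem_nhds h)
  rw [Metric.eventually_nhds_iff] at this
  obtain ⟨r, hr, h1⟩ := this
  exact ⟨r, hr, fun t h2 h3 => h1 (by rw [Real.dist_eq, abs_of_pos (by linarith)]; linarith)⟩

namespace PLeg

variable {c κ e δ : ℝ} {y q W P R : ℝ → ℝ}

theorem outcome (h : PLeg c κ e δ y q W P R) {T Q : ℝ} (hT : 0 < T)
    (hz : ptwE δ (y T) (W T) = 0)
    (hE : ∀ t, 0 ≤ t → t < T → ptwE δ (y t) (W t) < 0) {β η : ℝ} (b : PBar c δ β η)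
    (hQ1 : q 0 ≤ Q) (hQ2 : 21 ≤ c * Q) (s6 : 10 * κ * Q < δ ^ 2) :
    (y T = -2 ∧ 0 < q T) ∨ (W T = 2 * δ ∧ 0 ≤ y T ∧ 0 < R T ∧ (y T = 0 → q T < 0)) ∨
    (y T = 0 ∧ 2 * δ < W T ∧ q T < 0) ∨ (W T = 4 + 2 * δ ∧ y T < 0 ∧ 0 < R T) := by
  have N := h.nonpos_on hz hE
  have hδ := h.hδ
  have hd1 := h.d1
  have n := N T hT.le le_rfl
  have hnot : ¬ (ptwE δ (y T) (W T) < 0) := by rw [hz]; exact lt_irrefl _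
  rcases eq_or_lt_of_le n.1 with hy2 | hy2
  · left
    refine ⟨hy2.symm, ?_⟩
    by_contra hh
    have hle : q T ≤ 0 := not_lt.mp hh
    have key : ∃ r > 0, ∀ t, T - r < t → t < T → y t ≤ -2 := by
      rcases lt_or_eq_of_le hle with h1 | h1
      · obtain ⟨r, hr, h2⟩ := ptw_sign_left y _ T (h.hy T) (by linarith)
        exact ⟨r, hr, fun t ht ht' => by linarith [h2 t ht ht']⟩
      · have hP := h.hP T (by linarith) (by linarith)
        rw [← hy2, h1] at hP
        obtain ⟨r, hr, h2⟩ := ptw_sign_left q _ T (h.hq T) (by linarith)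
        refine ⟨r, hr, fun t ht ht' => ?_⟩
        have := ptw_lower y _ t T 0 h.hy ht'.le (fun x hx hx' => by
          have := h2 x (by linarith) hx'
          linarith)
        linarith
    obtain ⟨r, hr, h1⟩ := key
    have h2 := h1 (max 0 (T - r/2)) (lt_max_of_lt_right (by linarith)) (max_lt hT (by linarith))
    have h3 := ((ptwE_neg _ _ _).mp (hE (max 0 (T - r/2)) (le_max_left _ _)
      (max_lt hT (by linarith)))).1
    linarith
  · right
    rcases h.split hT hz hE with hs | ⟨t1, a1, a2, a3, a4, a5, a6, a7⟩
    · left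
      have hWT : W T = 2 * δ := by
        by_contra hne
        have := lt_of_le_of_ne (hs T hT.le le_rfl) hne
        exact hnot ((ptwE_neg _ _ _).mpr ⟨hy2, Or.inr this, by linarith⟩)
      have hy0 : 0 ≤ y T := by
        by_contra hne
        exact hnot ((ptwE_neg _ _ _).mpr ⟨hy2, Or.inl (not_le.mp hne), by linarith⟩)
      have hN : ∀ t, 0 ≤ t → t ≤ T → -2 ≤ y t ∧ W t ≤ 3 * δ := fun t ht ht' =>
        ⟨(N t ht ht').1, by linarith [hs t ht ht']⟩
      have f3 := h.front3 T hN T hT.le le_rfl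
      have hTc : ptwTc c e ≤ T := by
        by_contra hc
        have := f3.2.2.1 (not_le.mp hc).le
        linarith [h.W0b]
      have f2 := h.front2 T hN T hTc le_rfl
      refine ⟨hWT, hy0, by linarith [h.hR1 T, h.he], fun hyT => ?_⟩
      exact h.corner hT hz hE b hQ1 hQ2 s6 hs hyT hWT
    · right
      have hWT := (a7 T a2.le le_rfl).2
      have hp : 0 < κ * e * (T - t1) := by
        have := h.hκ; have := h.he
        apply mul_pos (by positivity); linarith
      rcases eq_or_lt_of_le (a7 T a2.le le_rfl).1 with h0 | h0
      · left
        exact ⟨h0, by linarith, h.exit_up a2 a6 h0 (by linarith)⟩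
      · right
        refine ⟨?_, h0, by linarith [h.hR1 T, h.he]⟩
        by_contra hne
        exact hnot ((ptwE_neg _ _ _).mpr ⟨hy2, Or.inl h0, lt_of_le_of_ne n.2.2 hne⟩)

theorem strict_exit (h : PLeg c κ e δ y q W P R) {T Q : ℝ} (hT : 0 < T)
    (hz : ptwE δ (y T) (W T) = 0)
    (hE : ∀ t, 0 ≤ t → t < T → ptwE δ (y t) (W t) < 0) {β η : ℝ} (b : PBar c δ β η)
    (hQ1 : q 0 ≤ Q) (hQ2 : 21 ≤ c * Q) (s6 : 10 * κ * Q < δ ^ 2) :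
    ∀ x > 0, ∃ t, T < t ∧ t < T + x ∧ 0 < ptwE δ (y t) (W t) := by
  have hκ := h.hκ
  have main : ∃ r > 0, ∀ t, T < t → t < T + r → 0 < ptwE δ (y t) (W t) := by
    rcases h.outcome hT hz hE b hQ1 hQ2 s6 with ⟨h1, h2⟩ | ⟨h1, h2, h3, h4⟩ | ⟨h1, h2, h3⟩ | ⟨h1, h2, h3⟩
    · obtain ⟨r, hr, h5⟩ := ptw_sign_right (fun t => - y t) _ T (h.hy T).neg (by linarith)
      exact ⟨r, hr, fun t ht ht' => (ptwE_pos _ _ _).mpr (Or.inl (by linarith [h5 t ht ht']))⟩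
    · obtain ⟨r, hr, h5⟩ := ptw_sign_right W _ T (h.hW T) (by positivity)
      have : ∃ r > 0, ∀ t, T < t → t < T + r → 0 < y t := by
        rcases eq_or_lt_of_le h2 with h6 | h6
        · obtain ⟨r, hr, h7⟩ := ptw_sign_right y _ T (h.hy T) (by linarith [h4 h6.symm])
          exact ⟨r, hr, fun t ht ht' => by linarith [h7 t ht ht']⟩
        · exact ptw_cont_right y h.cy T 0 h6
      obtain ⟨r', hr', h6⟩ := this
      refine ⟨min r r', lt_min hr hr', fun t ht ht' => (ptwE_pos _ _ _).mpr (Or.inr (Or.inl ?_))⟩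
      have := min_le_left r r'
      have := min_le_right r r'
      exact ⟨h6 t ht (by linarith), by linarith [h5 t ht (by linarith)]⟩
    · obtain ⟨r, hr, h5⟩ := ptw_sign_right y _ T (h.hy T) (by linarith)
      obtain ⟨r', hr', h6⟩ := ptw_cont_right W h.cW T _ h2
      refine ⟨min r r', lt_min hr hr', fun t ht ht' => (ptwE_pos _ _ _).mpr (Or.inr (Or.inl ?_))⟩
      have := min_le_left r r'
      have := min_le_right r r'
      exact ⟨by linarith [h5 t ht (by linarith)], h6 t ht (by linarith)⟩
    · obtain ⟨r, hr, h5⟩ := ptw_sign_right W _ T (h.hW T) (by positivity)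
      exact ⟨r, hr, fun t ht ht' => (ptwE_pos _ _ _).mpr (Or.inr (Or.inr (by linarith [h5 t ht ht'])))⟩
  obtain ⟨r, hr, h1⟩ := main
  intro x hx
  have hm : 0 < min r x := lt_min hr hx
  have m1 := min_le_left r x
  have m2 := min_le_right r x
  exact ⟨T + min r x / 2, by linarith, by linarith, h1 _ (by linarith) (by linarith)⟩

/-- value used to define the half-map -/
theorem genuine (h : PLeg c κ e δ y q W P R) {T Q : ℝ} (hT : 0 < T)
    (hz : ptwE δ (y T) (W T) = 0)
    (hE : ∀ t, 0 ≤ t → t < T → ptwE δ (y t) (W t) < 0) {β η : ℝ} (b : PBar c δ β η)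
    (hQ1 : q 0 ≤ Q) (hQ2 : 21 ≤ c * Q) (s6 : 10 * κ * Q < δ ^ 2)
    (hw1 : -(3 / 2 * δ) < 4 - W T - 3 * max 0 (-(y T)))
    (hw2 : 4 - W T - 3 * max 0 (-(y T)) < 3 / 2 * δ) :
    y T = 0 ∧ q T < 0 ∧ -(2 * β * (1 + η)) < q T := by
  have hδ := h.hδ
  have hd1 := h.d1
  have B := h.bounds hT hz hE T hT.le le_rfl
  have m1 := le_max_left 0 (-(y T))
  have m2 := le_max_right 0 (-(y T))
  rcases h.outcome hT hz hE b hQ1 hQ2 s6 with ⟨h1, h2⟩ | ⟨h1, h2, h3, h4⟩ | ⟨h1, h2, h3⟩ | ⟨h1, h2, h3⟩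
  · exfalso; linarith
  · exfalso
    rw [max_eq_left (by linarith)] at hw2
    linarith
  · exact ⟨h1, h3, h.caseE hT hz hE b h1 h3⟩
  · exfalso; linarith

theorem lowB (h : PLeg c κ e δ y q W P R) {T : ℝ} (hT : 0 < T)
    (hz : ptwE δ (y T) (W T) = 0)
    (hE : ∀ t, 0 ≤ t → t < T → ptwE δ (y t) (W t) < 0)
    (s5 : 10 * κ * (1 / c + 16 * c / δ) < δ) (hW0 : W 0 ≤ -δ) :
    4 - W T - 3 * max 0 (-(y T)) ≤ -(3 / 2 * δ) := by
  have h1 := h.caseB hT hz hE s5 hW0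
  have B := h.bounds hT hz hE T hT.le le_rfl
  have m2 := le_max_right 0 (-(y T))
  have hd1 := h.d1
  linarith

theorem highC (h : PLeg c κ e δ y q W P R) {T : ℝ} (hT : 0 < T)
    (hz : ptwE δ (y T) (W T) = 0)
    (hE : ∀ t, 0 ≤ t → t < T → ptwE δ (y t) (W t) < 0) {β η : ℝ} (b : PBar c δ β η)
    (hq0 : q 0 ≤ 2 * β * (1 + η)) (hW0 : δ ≤ W 0) :
    3 / 2 * δ ≤ 4 - W T - 3 * max 0 (-(y T)) := by
  have h1 := h.caseC hT hz hE b hq0 hW0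
  rw [max_eq_left (by linarith)]
  have hd1 := h.d1
  linarith

end PLeg

noncomputable def ptwH (W : ℝ) : ℝ := 1 - 2 * Real.cos (Real.arccos ((W - 2) / 2) / 3)

theorem ptwH_eq (W : ℝ) (h0 : 0 ≤ W) (h4 : W ≤ 4) : (ptwH W) ^ 2 * (3 - ptwH W) = W := by
  unfold ptwH
  set k := Real.cos (Real.arccos ((W - 2) / 2) / 3) with hk
  have h3 := Real.cos_three_mul (Real.arccos ((W - 2) / 2) / 3)
  rw [mul_div_cancel₀ _ (by norm_num : (3:ℝ) ≠ 0), Real.cos_arccos (by linarith) (by linarith),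
    ← hk] at h3
  linarith

theorem ptwH_mem (W : ℝ) : -1 ≤ ptwH W ∧ ptwH W ≤ 0 := by
  unfold ptwH
  have h1 := Real.cos_le_one (Real.arccos ((W - 2) / 2) / 3)
  have h2 : Real.cos (π / 3) ≤ Real.cos (Real.arccos ((W - 2) / 2) / 3) := by
    apply Real.cos_le_cos_of_nonneg_of_le_pi
    · have := Real.arccos_nonneg ((W - 2) / 2); positivity
    · linarith [Real.pi_pos]
    · have := Real.arccos_le_pi ((W - 2) / 2); linarith
  rw [Real.cos_pi_div_three] at h2
  constructor <;> linarith

theorem ptwH_der (W : ℝ) (h0 : 0 < W) (h4 : W < 4) :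
    ∃ d, HasDerivAt ptwH d W ∧ (6 * ptwH W - 3 * (ptwH W) ^ 2) * d = 1 := by
  have hin : HasDerivAt (fun W : ℝ => (W - 2) / 2) (1 / 2) W :=
    ((hasDerivAt_id W).sub_const 2).div_const 2
  have ha := (Real.hasDerivAt_arccos (x := (W - 2) / 2) (by intro h; linarith) (by intro h; linarith)).comp W hin
  have hd := (((ha.div_const 3).cos).const_mul 2).const_sub 1
  refine ⟨_, hd, ?_⟩
  set d := _root_.id (-(2 * (-Real.sin ((Real.arccos ∘ fun W : ℝ => (W - 2) / 2) W / 3) * (-(1 / √(1 - ((W - 2) / 2) ^ 2)) * (1 / 2) / 3)))) with hdd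
  have hd' : HasDerivAt ptwH d W := hd
  have hG : HasDerivAt (fun W => (ptwH W) ^ 2 * (3 - ptwH W)) _ W := (hd'.pow 2).mul (hd'.const_sub 3)
  have hG2 : HasDerivAt (fun W => (ptwH W) ^ 2 * (3 - ptwH W)) 1 W := by
    refine (hasDerivAt_id W).congr_of_eventuallyEq ?_
    filter_upwards [Ioo_mem_nhds h0 h4] with x hx
    exact ptwH_eq x hx.1.le hx.2.le
  have := hG.unique hG2
  have e : (6 * ptwH W - 3 * ptwH W ^ 2) * d = 1 := by
    rw [← this]; simp; ring
  exact e

noncomputable def ptwDen (b γ e x : ℝ) : ℝ := max e (1 + b + γ * (x ^ 2 * (3 - x) - 2) - x)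
noncomputable def ptwg (c b γ e x : ℝ) : ℝ := c * (6 * x - 3 * x ^ 2) / ptwDen b γ e x
noncomputable def ptwJ (c b γ e x : ℝ) : ℝ := ∫ s in (0:ℝ)..x, ptwg c b γ e s

theorem ptwg_cont (c b γ e : ℝ) (he : 0 < e) : Continuous (ptwg c b γ e) := by
  unfold ptwg ptwDen
  refine Continuous.div (by fun_prop) (by fun_prop) (fun x => ?_)
  have : e ≤ max e (1 + b + γ * (x ^ 2 * (3 - x) - 2) - x) := le_max_left _ _
  linarith

theorem ptwJ_der (c b γ e : ℝ) (he : 0 < e) (x : ℝ) :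
    HasDerivAt (ptwJ c b γ e) (ptwg c b γ e x) x :=
  intervalIntegral.integral_hasDerivAt_right ((ptwg_cont c b γ e he).intervalIntegrable _ _)
    ((ptwg_cont c b γ e he).stronglyMeasurableAtFilter _ _) (ptwg_cont c b γ e he).continuousAt

theorem ptwJ_mono (c b γ e : ℝ) (hc : 0 < c) (he : 0 < e) (x1 x0 : ℝ) (h : x1 ≤ x0)
    (h0 : x0 ≤ 0) :
    0 ≤ ptwJ c b γ e x1 - ptwJ c b γ e x0 ∧
    ptwJ c b γ e x1 - ptwJ c b γ e x0 ≤ c / e * (x1 ^ 2 * (3 - x1) - x0 ^ 2 * (3 - x0)) := by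
  have hden : ∀ x, e ≤ ptwDen b γ e x := fun x => le_max_left _ _
  constructor
  · have := ptw_upper _ _ x1 x0 0 (ptwJ_der c b γ e he) h (fun t h1 h2 => by
      unfold ptwg
      apply div_nonpos_of_nonpos_of_nonneg
      · nlinarith [mul_nonneg hc.le (sq_nonneg t)]
      · linarith [hden t])
    linarith
  · have hG : ∀ x : ℝ, HasDerivAt (fun x : ℝ => x ^ 2 * (3 - x)) (6 * x - 3 * x ^ 2) x := by
      intro x
      have := ((hasDerivAt_id x).pow 2).mul ((hasDerivAt_id x).const_sub 3)
      exact this.congr_deriv (by simp; ring)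
    have := ptw_lower (fun x => ptwJ c b γ e x - c / e * (x ^ 2 * (3 - x)))
      (fun x => ptwg c b γ e x - c / e * (6 * x - 3 * x ^ 2)) x1 x0 0
      (fun x => (ptwJ_der c b γ e he x).sub ((hG x).const_mul _)) h (fun t h1 h2 => by
      unfold ptwg
      have hd := hden t
      have h3 : 0 ≤ - (6 * t - 3 * t ^ 2) := by nlinarith [sq_nonneg t]
      have h4 : c / ptwDen b γ e t ≤ c / e := by gcongr
      have h5 := mul_nonneg h3 (sub_nonneg.mpr h4)
      have e1 : c * (6 * t - 3 * t ^ 2) / ptwDen b γ e t = c / ptwDen b γ e t * (6 * t - 3 * t ^ 2) := by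
        ring
      rw [e1]; nlinarith)
    linarith

theorem ptw_upper2 (φ φ' : ℝ → ℝ) (a b ρ : ℝ) (hab : a ≤ b)
    (hd : ∀ t, a ≤ t → t ≤ b → HasDerivAt φ (φ' t) t)
    (h : ∀ t, a < t → t < b → φ' t ≤ ρ) : φ b ≤ φ a + ρ * (b - a) := by
  have := antitoneOn_of_deriv_nonpos (convex_Icc a b) (f := fun t => φ t - ρ * t)
    (fun t ht => ((hd t ht.1 ht.2).sub ((hasDerivAt_id t).const_mul ρ)).continuousAt.continuousWithinAt)
    (fun t ht => by
      rw [interior_Icc] at ht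
      exact ((hd t ht.1.le ht.2.le).sub ((hasDerivAt_id t).const_mul ρ)).differentiableAt.differentiableWithinAt)
    (fun t ht => by
      rw [interior_Icc] at ht
      have h1 := ((hd t ht.1.le ht.2.le).sub ((hasDerivAt_id t).const_mul ρ)).deriv
      have h2 := h t ht.1 ht.2
      have : deriv (fun t => φ t - ρ * t) t = φ' t - ρ * 1 := h1
      rw [this]; linarith)
  have h3 := this ⟨le_rfl, hab⟩ ⟨hab, le_rfl⟩ hab
  simp only at h3
  linarith

noncomputable def ptwCp (c e Q : ℝ) : ℝ :=
  ptwTc c e + 16 * c / e + 2 * (20 * Q + 22 * c) / e + (4 * c / e ^ 2) * (5 * (Q + 2 * c) / c + 1)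

noncomputable def ptwZ (c y q W : ℝ) : ℝ :=
  -q * (W - y ^ 2 * (3 - y)) + c * (W * y - (y ^ 3 - y ^ 4 / 4))
noncomputable def ptwZd (c κ y q W P R : ℝ) : ℝ :=
  -P * (W - y ^ 2 * (3 - y)) + -q * (κ * R - (2 * y * (-q) * (3 - y) + y ^ 2 * (-(-q)))) +
    c * ((κ * R * y + W * (-q)) - (3 * y ^ 2 * (-q) - 4 * y ^ 3 * (-q) / 4))

theorem ptwZ_der (c κ : ℝ) (y q W P R : ℝ → ℝ) (t : ℝ) (hy : HasDerivAt y (-(q t)) t)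
    (hq : HasDerivAt q (P t) t) (hW : HasDerivAt W (κ * R t) t) :
    HasDerivAt (fun t => ptwZ c (y t) (q t) (W t)) (ptwZd c κ (y t) (q t) (W t) (P t) (R t)) t := by
  have y2 := hy.pow 2
  have y3 := hy.pow 3
  have y4 := hy.pow 4
  have := (hq.neg.mul (hW.sub (y2.mul (hy.const_sub 3)))).add
    (((hW.mul hy).sub (y3.sub (y4.div_const 4))).const_mul c)
  refine this.congr_deriv ?_
  simp [ptwZd]

theorem ptwZd_low (c κ y q W P R Q : ℝ) (hc : 0 < c) (hκ : 0 < κ) (hy0 : y ≤ 0) (hy2 : -2 ≤ y)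
    (hq1 : -Q ≤ q) (hq2 : q ≤ Q) (hR1 : -5 ≤ R) (hR2 : R ≤ 5)
    (hP : P = -c * q + y ^ 2 * (3 - y) - W) :
    (W - y ^ 2 * (3 - y)) ^ 2 - 5 * κ * (Q + 2 * c) ≤ ptwZd c κ y q W P R := by
  have e1 : ptwZd c κ y q W P R = (W - y ^ 2 * (3 - y)) ^ 2 + q ^ 2 * (3 * y ^ 2 - 6 * y)
      + κ * (R * (c * y - q)) := by
    unfold ptwZd
    rw [hP]; ring
  have e2 : 0 ≤ q ^ 2 * (3 * y ^ 2 - 6 * y) :=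
    mul_nonneg (sq_nonneg _) (by linarith [sq_nonneg y])
  have e3 : -(5 * (Q + 2 * c)) ≤ R * (c * y - q) := by
    have r1 : |R| ≤ 5 := abs_le.mpr ⟨by linarith, by linarith⟩
    have c1 : c * y ≤ 0 := mul_nonpos_of_nonneg_of_nonpos hc.le hy0
    have c2 : 0 ≤ c * (y + 2) := mul_nonneg hc.le (by linarith)
    have r2 : |c * y - q| ≤ Q + 2 * c := abs_le.mpr ⟨by linarith, by linarith⟩
    have r3 : |R * (c * y - q)| ≤ 5 * (Q + 2 * c) := by
      rw [abs_mul]; exact mul_le_mul r1 r2 (abs_nonneg _) (by norm_num)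
    linarith [(abs_le.mp r3).1]
  have e4 := mul_le_mul_of_nonneg_left e3 hκ.le
  rw [e1]; linarith

theorem ptwZ_bd (c y q W Q : ℝ) (hc : 0 < c) (hy0 : y ≤ 0) (hy2 : -2 ≤ y)
    (hq1 : -Q ≤ q) (hq2 : q ≤ Q) (hW0 : 0 ≤ W) (hW4 : W ≤ 4) :
    |ptwZ c y q W| ≤ 20 * Q + 22 * c := by
  have h4 : y ^ 2 ≤ 4 := by nlinarith
  have g0 : 0 ≤ y ^ 2 * (3 - y) := mul_nonneg (sq_nonneg _) (by linarith)
  have gu : y ^ 2 * (3 - y) ≤ 4 * 5 :=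
    mul_le_mul h4 (by linarith) (by linarith) (by norm_num)
  have r1 : |-q| ≤ Q := by rw [abs_neg]; exact abs_le.mpr ⟨by linarith, by linarith⟩
  have r2 : |W - y ^ 2 * (3 - y)| ≤ 20 := abs_le.mpr ⟨by linarith, by linarith⟩
  have r3 : |W * y - (y ^ 3 - y ^ 4 / 4)| ≤ 22 := by
    have f1 : -8 ≤ W * y := by nlinarith
    have f2 : W * y ≤ 0 := by nlinarith
    have e5 : y ^ 3 - y ^ 4 / 4 = -(y^2 * (-y + y^2 / 4)) := by ring
    have f3 : 0 ≤ y^2 * (-y + y^2 / 4) := mul_nonneg (sq_nonneg _) (by linarith [sq_nonneg y])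
    have f4 : y^2 * (-y + y^2 / 4) ≤ 4 * 3 :=
      mul_le_mul h4 (by linarith) (by linarith [sq_nonneg y]) (by norm_num)
    rw [e5, abs_le]; constructor <;> linarith
  calc |ptwZ c y q W| ≤ |-q * (W - y ^ 2 * (3 - y))| +
      |c * (W * y - (y ^ 3 - y ^ 4 / 4))| := abs_add_le _ _
    _ ≤ Q * 20 + c * 22 := by
      rw [abs_mul, abs_mul, abs_of_pos hc]
      have hQ : 0 ≤ Q := le_trans (abs_nonneg _) r1
      gcongr
    _ = _ := by ring

theorem ptw_point (δ κ e c Q D H y W Zd : ℝ) (hδ : 0 < δ) (he : 0 < e) (hd1 : 384 * δ < 1)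
    (hm1 : -1 ≤ H) (hm2 : H ≤ 0) (hH : H ^ 2 * (3 - H) = W) (hy : y ≤ 0) (hW : 2 * δ ≤ W)
    (hD : e ≤ D) (hZ : (W - y ^ 2 * (3 - y)) ^ 2 - 5 * κ * (Q + 2 * c) ≤ Zd) :
    |δ ^ 3 * ((H - y) / D)| ≤ δ / e * Zd + (5 * δ * κ * (Q + 2 * c) + δ ^ 4) / e := by
  obtain ⟨g, hg⟩ : ∃ g, g = W - y ^ 2 * (3 - y) := ⟨_, rfl⟩
  rw [← hg] at hZ
  have hge : g = (H - y) * (3 * (H + y) - (H ^ 2 + H * y + y ^ 2)) := by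
    rw [hg, ← hH]; ring
  have hS : 9 * H ^ 2 ≤ (3 * (H + y) - (H ^ 2 + H * y + y ^ 2)) ^ 2 := by
    have : 0 ≤ H * y := mul_nonneg_of_nonpos_of_nonpos hm2 hy
    have h1 : -3 * H ≤ -(3 * (H + y) - (H ^ 2 + H * y + y ^ 2)) := by
      linarith [sq_nonneg H, sq_nonneg y]
    have h2 := pow_le_pow_left₀ (by linarith : 0 ≤ -3 * H) h1 2
    linarith
  have hH2 : δ / 2 ≤ H ^ 2 := by
    have : H ^ 2 * (3 - H) ≤ H ^ 2 * 4 := mul_le_mul_of_nonneg_left (by linarith) (sq_nonneg _)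
    linarith
  have hg2 : (9 / 2 * δ) * (H - y) ^ 2 ≤ g ^ 2 := by
    rw [hge, mul_pow, mul_comm]
    exact mul_le_mul_of_nonneg_left (by linarith) (sq_nonneg _)
  have hab : δ ^ 3 * |H - y| ≤ δ * g ^ 2 + δ ^ 4 := by
    have h1 : 0 ≤ (δ * |H - y| - δ ^ 2) ^ 2 := sq_nonneg _
    have h2 : (δ * |H - y| - δ ^ 2) ^ 2 = δ * (δ * (H - y) ^ 2) - 2 * (δ ^ 3 * |H - y|) + δ ^ 4 := by
      rw [← sq_abs (H - y)]; ring
    have h3 : δ * (δ * (H - y) ^ 2) ≤ δ * g ^ 2 := by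
      apply mul_le_mul_of_nonneg_left _ hδ.le
      linarith [mul_nonneg hδ.le (sq_nonneg (H - y))]
    have h4 : 0 ≤ δ * g ^ 2 := by positivity
    have h5 : 0 ≤ δ ^ 4 := by positivity
    linarith
  rw [abs_mul, abs_div, abs_of_pos (by positivity : (0:ℝ) < δ ^ 3), abs_of_pos (by linarith : 0 < D), ← mul_div_assoc]
  have h6 : δ * g ^ 2 ≤ δ * (Zd + 5 * κ * (Q + 2 * c)) :=
    mul_le_mul_of_nonneg_left (by linarith) hδ.le
  calc δ ^ 3 * |H - y| / D ≤ δ ^ 3 * |H - y| / e := by gcongr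
    _ ≤ (δ * g ^ 2 + δ ^ 4) / e := by gcongr
    _ ≤ (δ * (Zd + 5 * κ * (Q + 2 * c)) + δ ^ 4) / e := by gcongr
    _ = _ := by ring

namespace PLeg

variable {c κ e δ : ℝ} {y q W P R : ℝ → ℝ}

set_option maxHeartbeats 1000000 in
theorem period (h : PLeg c κ e δ y q W P R) {T Q b γ : ℝ} (hT : 0 < T)
    (hz : ptwE δ (y T) (W T) = 0)
    (hE : ∀ t, 0 ≤ t → t < T → ptwE δ (y t) (W t) < 0)
    (hQ1 : q 0 ≤ Q) (hQ2 : 21 ≤ c * Q) (hκδ : κ * c = δ ^ 3)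
    (hRex : ∀ t, -(2 * δ) ≤ W t → W t ≤ 4 + 2 * δ → R t = 1 + b + γ * (W t - 2) - y t)
    (hγ : 0 < γ) (hb : |b| + 2 * γ + 2 * e ≤ 1)
    (hyT : y T = 0) (hWT : 4 - 3 / 2 * δ < W T) :
    |δ ^ 3 * T - ptwJ c b γ e (-1)| ≤ ptwCp c e Q * δ := by
  have hδ := h.hδ
  have hd1 := h.d1
  have hc := h.hc
  have hκ := h.hκ
  have he := h.he
  have B := h.bounds hT hz hE
  have QB := h.qbound hT hz hE hQ1 hQ2
  have hQ0 : 0 ≤ Q := h.q0.trans hQ1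
  rcases h.split hT hz hE with hs | ⟨t1, a1, a2, a3, a4, a5, a6, a7⟩
  · exfalso
    linarith [hs T hT.le le_rfl]
  obtain ⟨t2, b1, b2, b3, b4⟩ := ptw_first (fun t => W t - (4 - 2 * δ))
    (by have := h.cW; fun_prop) t1 T a2.le (by linarith) (by linarith)
  have hW2 : W t2 = 4 - 2 * δ := by linarith
  have hRe : ∀ t, t1 ≤ t → t ≤ T → e ≤ R t := fun t h1 h2 => by
    linarith [h.hR1 t, (a7 t h1 h2).1]
  have hWr : ∀ t, t1 ≤ t → t ≤ t2 → 2 * δ ≤ W t ∧ W t ≤ 4 - 2 * δ := by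
    intro t h1 h2
    constructor
    · have := (a7 t h1 (by linarith)).2
      have h3 : 0 ≤ κ * e * (t - t1) := mul_nonneg (by positivity) (by linarith)
      linarith
    · rcases eq_or_lt_of_le h2 with h3 | h3
      · rw [h3]; exact hW2.le
      · linarith [b4 t h1 h3]
  -- time bounds
  have tb1 : δ ^ 3 * (t2 - t1) ≤ 4 * c / e := by
    have := (a7 t2 b1.le b2).2
    have h1 : κ * e * (t2 - t1) ≤ 4 := by linarith
    rw [le_div_iff₀ he, ← hκδ]; nlinarith
  have tb2 : δ ^ 3 * (T - t2) ≤ 4 * c / e * δ := by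
    have := ptw_lower W _ t2 T (κ * e) h.hW b2 (fun s g1 g2 => by
      have := hRe s (by linarith) g2.le
      gcongr)
    have h2 := (B T hT.le le_rfl).2.2.2
    have h1 : κ * e * (T - t2) ≤ 4 * δ := by linarith
    have e1 : 4 * c / e * δ = (4 * c * δ) / e := by ring
    rw [e1, le_div_iff₀ he, ← hκδ]; nlinarith
  have tb0 : δ ^ 3 * t1 ≤ ptwTc c e * δ + 8 * c / e * δ := by
    have h1 : δ ^ 3 * t1 ≤ δ ^ 3 * (ptwTc c e + 8 * δ / (κ * e)) := by gcongr
    have h2 : δ ^ 3 * (8 * δ / (κ * e)) = 8 * c / e * δ := by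
      rw [← hκδ]; field_simp
    have h3 : δ ^ 3 * ptwTc c e ≤ δ * ptwTc c e := by
      have := h.Tc_pos
      gcongr
      have : δ ^ 2 ≤ 1 := by nlinarith
      calc δ ^ 3 = δ ^ 2 * δ := by ring
        _ ≤ 1 * δ := by gcongr
        _ = δ := one_mul _
    linarith
  -- the integral function
  obtain ⟨J, hJ⟩ : ∃ J, J = ptwJ c b γ e := ⟨_, rfl⟩
  have hden : ∀ x, -1 ≤ x → x ≤ 0 →
      ptwDen b γ e x = 1 + b + γ * (x ^ 2 * (3 - x) - 2) - x := by
    intro x hx hx'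
    unfold ptwDen
    apply max_eq_right
    have h1 : 0 ≤ γ * (x ^ 2 * (3 - x)) := by
      apply mul_nonneg hγ.le; apply mul_nonneg (sq_nonneg _); linarith
    have := neg_abs_le b
    linarith
  have hden' : ∀ x, e ≤ ptwDen b γ e x := fun x => le_max_left _ _
  have hJd : ∀ t, t1 ≤ t → t ≤ t2 → HasDerivAt (fun t => J (ptwH (W t)))
      (δ ^ 3 * (1 + (ptwH (W t) - y t) / ptwDen b γ e (ptwH (W t)))) t := by
    intro t g1 g2
    rw [hJ]
    have w := hWr t g1 g2
    obtain ⟨d, hd, hd1⟩ := ptwH_der (W t) (by linarith) (by linarith)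
    have hm := ptwH_mem (W t)
    have hH := ptwH_eq (W t) (by linarith) (by linarith)
    have hD := hden _ hm.1 hm.2
    rw [hH] at hD
    have hR := hRex t (by linarith) (by linarith)
    have hcomp := (ptwJ_der c b γ e he (ptwH (W t))).comp t (hd.comp t (h.hW t))
    have hR' : R t = ptwDen b γ e (ptwH (W t)) + (ptwH (W t) - y t) := by rw [hD, hR]; ring
    have hne : ptwDen b γ e (ptwH (W t)) ≠ 0 := by linarith [hden' (ptwH (W t))]
    have e1 : c * (6 * ptwH (W t) - 3 * ptwH (W t) ^ 2) / ptwDen b γ e (ptwH (W t)) * (d * (κ * R t))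
        = ((6 * ptwH (W t) - 3 * ptwH (W t) ^ 2) * d) * (κ * c) * R t / ptwDen b γ e (ptwH (W t)) := by
      ring
    have e2 : 1 * δ ^ 3 * (ptwDen b γ e (ptwH (W t)) + (ptwH (W t) - y t)) / ptwDen b γ e (ptwH (W t)) =
        δ ^ 3 * (1 + (ptwH (W t) - y t) / ptwDen b γ e (ptwH (W t))) := by
      field_simp
    rw [hd1, hκδ, hR', e2] at e1
    exact hcomp.congr_deriv (by unfold ptwg; rw [hR']; exact e1)
  -- the Lyapunov-type function
  obtain ⟨Z, hZ⟩ : ∃ Z : ℝ → ℝ, Z = fun t => ptwZ c (y t) (q t) (W t) := ⟨_, rfl⟩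
  obtain ⟨Z', hZ'⟩ : ∃ Z : ℝ → ℝ, Z = fun t => ptwZd c κ (y t) (q t) (W t) (P t) (R t) := ⟨_, rfl⟩
  have hZd : ∀ t, HasDerivAt Z (Z' t) t := by
    intro t
    rw [hZ, hZ']
    exact ptwZ_der c κ y q W P R t (h.hy t) (h.hq t) (h.hW t)
  have hZl : ∀ t, t1 ≤ t → t ≤ t2 →
      (W t - (y t) ^ 2 * (3 - y t)) ^ 2 - 5 * κ * (Q + 2 * c) ≤ Z' t := by
    intro t g1 g2
    have n := B t (by linarith) (by linarith)
    have m := (a7 t g1 (by linarith)).1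
    have hq := QB t (by linarith) (by linarith)
    have hR := h.frontR t n.1 n.2.1
    rw [hZ']
    exact ptwZd_low c κ _ _ _ _ _ Q hc hκ m n.1 (by linarith) (by linarith) (by linarith)
      (by linarith) (h.hP t (by linarith) (by linarith))
  have hZb : ∀ t, t1 ≤ t → t ≤ t2 → |Z t| ≤ 20 * Q + 22 * c := by
    intro t g1 g2
    have n := B t (by linarith) (by linarith)
    have m := (a7 t g1 (by linarith)).1
    have hq := QB t (by linarith) (by linarith)
    have w := hWr t g1 g2
    rw [hZ]
    exact ptwZ_bd c _ _ _ Q hc m n.1 (by linarith) (by linarith) (by linarith) (by linarith)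
  clear hZ hZ'
  obtain ⟨ρ, hρ⟩ : ∃ ρ, ρ = (5 * δ * κ * (Q + 2 * c) + δ ^ 4) / e := ⟨_, rfl⟩
  have hpt : ∀ t, t1 ≤ t → t ≤ t2 →
      |δ ^ 3 * ((ptwH (W t) - y t) / ptwDen b γ e (ptwH (W t)))| ≤ δ / e * Z' t + ρ := by
    intro t g1 g2
    have m := (a7 t g1 (by linarith)).1
    have w := hWr t g1 g2
    have hm := ptwH_mem (W t)
    have hH := ptwH_eq (W t) (by linarith) (by linarith)
    rw [hρ]
    exact ptw_point δ κ e c Q _ _ _ _ _ hδ he hd1 hm.1 hm.2 hH m w.1 (hden' _) (hZl t g1 g2)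
  have up1 := ptw_upper2 (fun t => J (ptwH (W t)) - δ ^ 3 * t - δ / e * Z t)
    (fun t => δ ^ 3 * (1 + (ptwH (W t) - y t) / ptwDen b γ e (ptwH (W t))) - δ ^ 3 * 1 - δ / e * Z' t)
    t1 t2 ρ b1.le (fun t g1 g2 => ((hJd t g1 g2).sub ((hasDerivAt_id t).const_mul _)).sub
      ((hZd t).const_mul _)) (fun t g1 g2 => by
      have := (abs_le.mp (hpt t g1.le g2.le)).2
      linarith)
  have up2 := ptw_upper2 (fun t => δ ^ 3 * t - J (ptwH (W t)) - δ / e * Z t)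
    (fun t => δ ^ 3 * 1 - δ ^ 3 * (1 + (ptwH (W t) - y t) / ptwDen b γ e (ptwH (W t))) - δ / e * Z' t)
    t1 t2 ρ b1.le (fun t g1 g2 => (((hasDerivAt_id t).const_mul _).sub (hJd t g1 g2)).sub
      ((hZd t).const_mul _)) (fun t g1 g2 => by
      have := (abs_le.mp (hpt t g1.le g2.le)).1
      linarith)
  have z1 := abs_le.mp (hZb t1 le_rfl b1.le)
  have z2 := abs_le.mp (hZb t2 b1.le le_rfl)
  have zz1 : δ / e * (Z t2 - Z t1) ≤ δ / e * (2 * (20 * Q + 22 * c)) := by gcongr; linarith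
  have zz3 : ρ * (t2 - t1) ≤ (4 * c / e ^ 2) * (5 * (Q + 2 * c) / c + 1) * δ := by
    have e1 : ρ * (t2 - t1) = (δ ^ 3 * (t2 - t1)) * (δ / e * (5 * (Q + 2 * c) / c + 1)) := by
      rw [hρ]
      have : κ = δ ^ 3 / c := by rw [← hκδ]; field_simp
      rw [this]; field_simp
    have e2 : (4 * c / e ^ 2) * (5 * (Q + 2 * c) / c + 1) * δ =
        (4 * c / e) * (δ / e * (5 * (Q + 2 * c) / c + 1)) := by
      field_simp
    rw [e1, e2]
    gcongr
  have hm2 := ptwH_mem (W t2)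
  have hm1 := ptwH_mem (W t1)
  have j1 := ptwJ_mono c b γ e hc he (-1) (ptwH (W t2)) hm2.1 hm2.2
  have j0 := ptwJ_mono c b γ e hc he (ptwH (W t1)) 0 hm1.2 le_rfl
  rw [← hJ]
  have hJ0 : ptwJ c b γ e 0 = 0 := by unfold ptwJ; simp
  rw [ptwH_eq _ (by linarith) (by linarith), hW2] at j1
  rw [ptwH_eq _ (by linarith) (by linarith), a4, hJ0] at j0
  rw [← hJ] at j0 j1
  have k1 : c / e * ((-1) ^ 2 * (3 - -1) - (4 - 2 * δ)) = 2 * c / e * δ := by ring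
  have k0 : c / e * (2 * δ - 0 ^ 2 * (3 - 0)) = 2 * c / e * δ := by ring
  rw [k1] at j1
  rw [k0] at j0
  have p3 : 0 ≤ δ ^ 3 * t1 := by positivity
  have p4 : 0 ≤ δ ^ 3 * (T - t2) := mul_nonneg (by positivity) (by linarith)
  have hCp : ptwCp c e Q * δ = ptwTc c e * δ + 8 * c / e * δ + 4 * c / e * δ + 2 * c / e * δ
      + 2 * c / e * δ + δ / e * (2 * (20 * Q + 22 * c)) +
      (4 * c / e ^ 2) * (5 * (Q + 2 * c) / c + 1) * δ := by
    unfold ptwCp; ring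
  have q1 : δ / e * (Z t2 - Z t1) = δ / e * Z t2 - δ / e * Z t1 := by ring
  have p5 : 0 ≤ 2 * c / e * δ := by positivity
  have hTcp : 0 ≤ ptwTc c e * δ := mul_nonneg h.Tc_pos.le hδ.le
  have p6 : 0 ≤ 4 * c / e * δ := by positivity
  have p7 : 0 ≤ 8 * c / e * δ := by positivity
  rw [hW2, a4] at up1 up2
  rw [hCp, abs_le]
  constructor
  · linarith
  · linarith

end PLeg

noncomputable def ptwCl (l r x : ℝ) : ℝ := max l (min r x)

theorem ptwCl_id {l r x : ℝ} (h1 : l ≤ x) (h2 : x ≤ r) : ptwCl l r x = x := by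
  unfold ptwCl; rw [min_eq_right h2, max_eq_right h1]

theorem ptwCl_low {l r x : ℝ} (hlr : l ≤ r) (h1 : x ≤ l) : ptwCl l r x = l := by
  unfold ptwCl; rw [min_eq_right (by linarith), max_eq_left h1]

theorem ptwCl_high {l r x : ℝ} (hlr : l ≤ r) (h1 : r ≤ x) : ptwCl l r x = r := by
  unfold ptwCl; rw [min_eq_left h1, max_eq_right hlr]

theorem ptwCl_mem {l r : ℝ} (x : ℝ) (hlr : l ≤ r) : l ≤ ptwCl l r x ∧ ptwCl l r x ≤ r :=
  ⟨le_max_left _ _, max_le hlr (min_le_left _ _)⟩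

theorem ptwCl_cont (l r : ℝ) : Continuous (ptwCl l r) := by
  unfold ptwCl; fun_prop

theorem ptwCl_lip (l r x y : ℝ) : |ptwCl l r x - ptwCl l r y| ≤ |x - y| := by
  have h : LipschitzWith 1 (ptwCl l r) := (LipschitzWith.id.const_min r).const_max l
  have := h.dist_le_mul x y
  simpa [Real.dist_eq] using this

theorem ptwCl_inner {l r x : ℝ} (hlr : l ≤ r) (h1 : l < ptwCl l r x) (h2 : ptwCl l r x < r) :
    ptwCl l r x = x := by
  rcases le_or_gt x l with h | h
  · rw [ptwCl_low hlr h] at h1; linarith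
  rcases le_or_gt r x with h' | h'
  · rw [ptwCl_high hlr h'] at h2; linarith
  exact ptwCl_id h.le h'.le

theorem ptwCl_refl (l r x s : ℝ) (h : r = s - l) (hlr : l ≤ r) : ptwCl l r (s - x) = s - ptwCl l r x := by
  rcases le_or_gt x l with h1 | h1
  · rw [ptwCl_low hlr h1, ptwCl_high hlr (by linarith)]; linarith
  rcases le_or_gt r x with h' | h'
  · rw [ptwCl_high hlr h', ptwCl_low hlr (by linarith)]; linarith
  rw [ptwCl_id h1.le h'.le, ptwCl_id (by linarith) (by linarith)]

noncomputable def ptwV (c κ e γ b : ℝ) (p : ℝ × ℝ × ℝ) : ℝ × ℝ × ℝ :=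
  (-p.2.1, -c * p.2.1 + (ptwCl (-3) 5 p.1) ^ 2 * (3 - ptwCl (-3) 5 p.1) - p.2.2,
    κ * (1 + b + γ * ptwCl (-2 - e) (2 + e) (p.2.2 - 2) - p.1))

theorem ptwV_lip (c κ e γ b : ℝ) (hc : 0 < c) (hκ : 0 < κ) (hγ : 0 < γ) :
    ∃ K, LipschitzWith K (ptwV c κ e γ b) := by
  refine ⟨⟨107 + c + κ * (γ + 1), by positivity⟩, LipschitzWith.of_dist_le_mul ?_⟩
  rintro ⟨y, q, W⟩ ⟨y', q', W'⟩
  have hD : dist (y, q, W) (y', q', W') = max |y - y'| (max |q - q'| |W - W'|) := by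
    simp [Prod.dist_eq, Real.dist_eq]
  rw [hD]
  obtain ⟨d, hd⟩ : ∃ d, d = max |y - y'| (max |q - q'| |W - W'|) := ⟨_, rfl⟩
  rw [← hd]
  have d1 : |y - y'| ≤ d := hd ▸ le_max_left _ _
  have d2 : |q - q'| ≤ d := hd ▸ (le_max_left _ _).trans (le_max_right _ _)
  have d3 : |W - W'| ≤ d := hd ▸ (le_max_right _ _).trans (le_max_right _ _)
  have d0 : 0 ≤ d := (abs_nonneg _).trans d1
  have x1 := ptwCl_lip (-3) 5 y y'
  have x2 := ptwCl_lip (-2 - e) (2 + e) (W - 2) (W' - 2)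
  have m1 := ptwCl_mem (l := -3) (r := 5) y (by norm_num)
  have m2 := ptwCl_mem (l := -3) (r := 5) y' (by norm_num)
  change dist (ptwV c κ e γ b (y, q, W)) (ptwV c κ e γ b (y', q', W')) ≤ (107 + c + κ * (γ + 1)) * d
  unfold ptwV
  simp only [Prod.dist_eq, Real.dist_eq]
  generalize ptwCl (-3) 5 y = x at *
  generalize ptwCl (-3) 5 y' = x' at *
  generalize ptwCl (-2 - e) (2 + e) (W - 2) = z at *
  generalize ptwCl (-2 - e) (2 + e) (W' - 2) = z' at *
  have p1 : 0 ≤ c * d := by positivity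
  have p2 : 0 ≤ κ * γ * d := by positivity
  have p3 : 0 ≤ κ * d := by positivity
  rw [max_le_iff, max_le_iff]
  refine ⟨?_, ?_, ?_⟩
  · have e1 : -q - -q' = -(q - q') := by ring
    rw [e1, abs_neg]; nlinarith
  · have e1 : -c * q + x ^ 2 * (3 - x) - W - (-c * q' + x' ^ 2 * (3 - x') - W') =
      -(c * (q - q')) + (x - x') * (3 * (x + x') - (x ^ 2 + x * x' + x' ^ 2)) - (W - W') := by ring
    have e2 : |3 * (x + x') - (x ^ 2 + x * x' + x' ^ 2)| ≤ 105 := by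
      rw [abs_le]; constructor <;> nlinarith
    have e3 : |(x - x') * (3 * (x + x') - (x ^ 2 + x * x' + x' ^ 2))| ≤ d * 105 := by
      rw [abs_mul]; exact mul_le_mul (x1.trans d1) e2 (abs_nonneg _) d0
    have e4 : |-(c * (q - q'))| ≤ c * d := by
      rw [abs_neg, abs_mul, abs_of_pos hc]; gcongr
    rw [e1]
    refine (abs_sub _ _).trans ((add_le_add (abs_add_le _ _) le_rfl).trans ?_)
    linarith
  · have e1 : κ * (1 + b + γ * z - y) - κ * (1 + b + γ * z' - y') = κ * (γ * (z - z')) - κ * (y - y') := by ring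
    have e5 : |z - z'| ≤ d := by
      refine x2.trans (le_trans (le_of_eq ?_) d3); congr 1; ring
    have e4 : |κ * (γ * (z - z'))| ≤ κ * (γ * d) := by
      rw [abs_mul, abs_mul, abs_of_pos hκ, abs_of_pos hγ]; gcongr
    have e6 : |κ * (y - y')| ≤ κ * d := by
      rw [abs_mul, abs_of_pos hκ]; gcongr
    rw [e1]
    refine (abs_sub _ _).trans ?_
    linarith

noncomputable def ptwS (p : ℝ × ℝ × ℝ) : ℝ × ℝ × ℝ := (2 - p.1, -p.2.1, 4 - p.2.2)

theorem ptwS_der (c κ e γ b : ℝ) (he : 0 < e) (X : ℝ → ℝ × ℝ × ℝ) (t : ℝ)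
    (h : HasDerivAt X (ptwV c κ e γ (-b) (X t)) t) :
    HasDerivAt (fun t => ptwS (X t)) (ptwV c κ e γ b (ptwS (X t))) t := by
  have h1 : HasDerivAt (fun t => (X t).1) (ptwV c κ e γ (-b) (X t)).1 t := h.fst
  have h2 : HasDerivAt (fun t => (X t).2.1) (ptwV c κ e γ (-b) (X t)).2.1 t := h.snd.fst
  have h3 : HasDerivAt (fun t => (X t).2.2) (ptwV c κ e γ (-b) (X t)).2.2 t := h.snd.snd
  have := (h1.const_sub 2).prodMk (h2.neg.prodMk (h3.const_sub 4))
  refine this.congr_deriv ?_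
  unfold ptwV ptwS
  simp only
  rw [ptwCl_refl (-3) 5 _ 2 (by norm_num) (by norm_num)]
  have e1 : 4 - (X t).2.2 - 2 = 0 - ((X t).2.2 - 2) := by ring
  rw [e1, ptwCl_refl (-2 - e) (2 + e) _ 0 (by ring) (by linarith)]
  ext
  · simp
  · simp only; ring
  · simp only; ring

structure PPar (c κ e δ β η Q γ : ℝ) : Prop where
  hc : 0 < c
  hκ : κ * c = δ ^ 3
  he : 0 < e
  he1 : e < 1
  hδ : 0 < δ
  s1 : 6 * δ ≤ c ^ 2
  s2 : 384 * δ ≤ e ^ 2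
  s3 : 24 * δ ≤ e * c ^ 2
  s4 : 10 * κ * ptwTc c e < δ
  bar : PBar c δ β η
  hQ1 : 2 * β * (1 + η) ≤ Q
  hQ2 : 21 ≤ c * Q
  s5 : 10 * κ * (1 / c + 16 * c / δ) < δ
  s6 : 10 * κ * Q < δ ^ 2
  hγ : 0 < γ

structure PHalf (c e δ B b γ Q : ℝ) (X : ℝ → ℝ × ℝ × ℝ) (T : ℝ) (p p' : ℝ × ℝ) : Prop where
  T0 : 0 < T
  box1 : -(3 / 2 * δ) ≤ p'.1
  box2 : p'.1 ≤ 3 / 2 * δ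
  box3 : 0 ≤ p'.2
  box4 : p'.2 ≤ B
  low : p.1 ≤ -δ → p'.1 = -(3 / 2 * δ)
  high : δ ≤ p.1 → p'.1 = 3 / 2 * δ
  ends : -(3 / 2 * δ) < p'.1 → p'.1 < 3 / 2 * δ → X T = (0, -p'.2, 4 - p'.1) ∧ 0 < p'.2 ∧
    |δ ^ 3 * T - ptwJ c b γ e (-1)| ≤ ptwCp c e Q * δ
  bnd : ∀ t, 0 ≤ t → t ≤ T → -2 ≤ (X t).1 ∧ (X t).1 ≤ 2 ∧ -(2 * δ) ≤ (X t).2.2 ∧ (X t).2.2 ≤ 4 + 2 * δ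
  lt2 : 0 < p.2 → ∀ t, 0 < t → t ≤ T → (X t).1 < 2
  ent : ∀ t, 0 ≤ t → t < T → (X t).1 < 0 ∨ (X t).2.2 < 2 * δ

theorem ptw_leg {c κ e δ β η Q γ : ℝ} (P : PPar c κ e δ β η Q γ) (b : ℝ)
    (hb : |b| + 2 * γ + 2 * e ≤ 1) (X : ℝ → ℝ × ℝ × ℝ)
    (hX : ∀ t, HasDerivAt X (ptwV c κ e γ b (X t)) t)
    (h1 : (X 0).1 = 2) (h2 : 0 ≤ (X 0).2.1) (h3 : -(3 / 2 * δ) ≤ (X 0).2.2)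
    (h4 : (X 0).2.2 ≤ 3 / 2 * δ) :
    PLeg c κ e δ (fun t => (X t).1) (fun t => (X t).2.1) (fun t => (X t).2.2)
      (fun t => (ptwV c κ e γ b (X t)).2.1)
      (fun t => 1 + b + γ * ptwCl (-2 - e) (2 + e) ((X t).2.2 - 2) - (X t).1) where
  hc := P.hc
  hκ := by
    have := P.hκ
    have h1 : 0 < κ * c := by rw [this]; have := P.hδ; positivity
    exact (pos_iff_pos_of_mul_pos h1).mpr P.hc
  he := P.he
  he1 := P.he1
  hδ := P.hδ
  s1 := P.s1
  s2 := P.s2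
  s3 := P.s3
  s4 := P.s4
  hy := fun t => (hX t).fst
  hq := fun t => (hX t).snd.fst
  hP := fun t g1 g2 => by
    simp only [ptwV]
    rw [ptwCl_id g1 g2]
  hW := fun t => (hX t).snd.snd
  hR1 := fun t => by
    have he := P.he
    have m := ptwCl_mem (l := -2 - e) (r := 2 + e) ((X t).2.2 - 2) (by linarith)
    have h5 := mul_le_mul_of_nonneg_left m.1 P.hγ.le
    have h6 := neg_abs_le b
    have h7 := abs_nonneg b
    have h8 : γ * e ≤ 1 * e := mul_le_mul_of_nonneg_right (by linarith) he.le
    linarith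
  hR2 := fun t => by
    have he := P.he
    have m := ptwCl_mem (l := -2 - e) (r := 2 + e) ((X t).2.2 - 2) (by linarith)
    have h5 := mul_le_mul_of_nonneg_left m.2 P.hγ.le
    have h6 := le_abs_self b
    have h7 := abs_nonneg b
    have h8 : γ * e ≤ 1 * e := mul_le_mul_of_nonneg_right (by linarith) he.le
    linarith
  y0 := h1
  q0 := h2
  W0a := h3
  W0b := h4

theorem ptw_half {c κ e δ β η Q γ : ℝ} (P : PPar c κ e δ β η Q γ) (b : ℝ)
    (hb : |b| + 2 * γ + 2 * e ≤ 1) (φ : ℝ × ℝ × ℝ → ℝ → ℝ × ℝ × ℝ)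
    (hφ0 : ∀ x, φ x 0 = x)
    (hφ : ∀ x t, HasDerivAt (φ x) (ptwV c κ e γ b (φ x t)) t)
    (hφc : Continuous (fun p : (ℝ × ℝ × ℝ) × ℝ => φ p.1 |p.2|)) :
    ∃ (T : ℝ × ℝ → ℝ) (Φ : ℝ × ℝ → ℝ × ℝ), Continuous Φ ∧
      ∀ p : ℝ × ℝ, -(3 / 2 * δ) ≤ p.1 → p.1 ≤ 3 / 2 * δ → 0 ≤ p.2 → p.2 ≤ 2 * β * (1 + η) →
        PHalf c e δ (2 * β * (1 + η)) b γ Q (φ (2, p.2, p.1)) (T p) p (Φ p) := by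
  have hδ := P.hδ
  have hβ := P.bar.hβ
  have hη := P.bar.hη
  have hB : 0 ≤ 2 * β * (1 + η) := by positivity
  have hD : -(3 / 2 * δ) ≤ 3 / 2 * δ := by linarith
  obtain ⟨B, hBd⟩ : ∃ B, B = 2 * β * (1 + η) := ⟨_, rfl⟩
  obtain ⟨st, hst⟩ : ∃ st : ℝ × ℝ → ℝ × ℝ × ℝ,
    st = fun p => (2, ptwCl 0 B p.2, ptwCl (-(3 / 2 * δ)) (3 / 2 * δ) p.1) := ⟨_, rfl⟩
  have hstc : Continuous st := by
    rw [hst]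
    have c1 := ptwCl_cont 0 B
    have c2 := ptwCl_cont (-(3 / 2 * δ)) (3 / 2 * δ)
    fun_prop
  have leg := fun p : ℝ × ℝ => ptw_leg P b hb (φ (st p)) (hφ (st p)) (by rw [hφ0, hst])
    (by rw [hφ0, hst]; exact (ptwCl_mem _ (hBd ▸ hB)).1)
    (by rw [hφ0, hst]; exact (ptwCl_mem _ hD).1) (by rw [hφ0, hst]; exact (ptwCl_mem _ hD).2)
  have hq0B : ∀ p, (φ (st p) 0).2.1 ≤ 2 * β * (1 + η) := fun p => by
    rw [hφ0, hst, ← hBd]; exact (ptwCl_mem _ (hBd ▸ hB)).2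
  have hq0 : ∀ p, (φ (st p) 0).2.1 ≤ Q := fun p => (hq0B p).trans P.hQ1
  choose T hT0 _ hTz hTE using fun p => (leg p).exit_exists
  have hTc : Continuous T := by
    refine ptw_exit_continuous (fun p t => ptwE δ (φ (st p) t).1 (φ (st p) t).2.2) ?_ T
      (fun p => (hT0 p).le) hTE hTz
      (fun p => (leg p).strict_exit (hT0 p) (hTz p) (hTE p) P.bar (hq0 p) P.hQ2 P.s6)
    have h1 : Continuous (fun p : (ℝ × ℝ) × ℝ => φ (st p.1) |p.2|) :=
      hφc.comp (by fun_prop : Continuous fun p : (ℝ × ℝ) × ℝ => (st p.1, p.2))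
    have h2 : Continuous (fun x : ℝ × ℝ × ℝ => ptwE δ x.1 x.2.2) := by unfold ptwE; fun_prop
    exact h2.comp h1
  have hec : Continuous (fun p => φ (st p) (T p)) := by
    have h1 : Continuous (fun p : ℝ × ℝ => φ (st p) |T p|) :=
      hφc.comp (by fun_prop : Continuous fun p : ℝ × ℝ => (st p, T p))
    refine h1.congr (fun p => ?_)
    rw [abs_of_pos (hT0 p)]
  refine ⟨T, fun p => (ptwCl (-(3 / 2 * δ)) (3 / 2 * δ)
    (4 - (φ (st p) (T p)).2.2 - 3 * max 0 (-(φ (st p) (T p)).1)), ptwCl 0 B (-(φ (st p) (T p)).2.1)), ?_, ?_⟩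
  · have c1 := ptwCl_cont 0 B
    have c2 := ptwCl_cont (-(3 / 2 * δ)) (3 / 2 * δ)
    have d1 : Continuous (fun x : ℝ × ℝ × ℝ => 4 - x.2.2 - 3 * max 0 (-x.1)) := by fun_prop
    have d2 : Continuous (fun x : ℝ × ℝ × ℝ => -x.2.1) := by fun_prop
    exact (c2.comp (d1.comp hec)).prodMk (c1.comp (d2.comp hec))
  intro p p1 p2 p3 p4
  have hs : st p = (2, p.2, p.1) := by
    rw [hst]; simp only
    rw [ptwCl_id p3 (hBd ▸ p4), ptwCl_id p1 p2]
  have l := leg p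
  have e2 := hT0 p
  have e3 := hTz p
  have e4 := hTE p
  have e5 := hq0 p
  have e6 := hq0B p
  rw [hs] at l e3 e4 e5 e6
  simp only [hs]
  have g2 := l.genuine e2 e3 e4 P.bar e5 P.hQ2 P.s6
  have g3 := l.lowB e2 e3 e4 P.s5
  have g4 := l.highC e2 e3 e4 P.bar e6
  have g5 := l.bounds e2 e3 e4
  have g6 := l.lt_two e2 e3 e4
  have g7 := fun h1 h2 => l.period (Q := Q) (b := b) (γ := γ) e2 e3 e4 e5 P.hQ2 P.hκ (fun t h1 h2 => by
    have : 384 * δ ≤ e ^ 2 := P.s2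
    have he := P.he
    have he1 := P.he1
    have : e ^ 2 ≤ e := by nlinarith
    rw [ptwCl_id (by linarith) (by linarith)]) P.hγ hb h1 h2
  have h0 := hφ0 (2, p.2, p.1)
  simp only [h0] at g2 g3 g4 g5 g6 g7
  generalize φ (2, p.2, p.1) = X at *
  have m1 := ptwCl_mem (l := -(3 / 2 * δ)) (r := 3 / 2 * δ) (4 - (X (T p)).2.2 - 3 * max 0 (-(X (T p)).1)) hD
  have m2 := ptwCl_mem (l := 0) (r := B) (-(X (T p)).2.1) (hBd ▸ hB)
  rw [← hBd]
  exact {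
    T0 := e2
    box1 := m1.1
    box2 := m1.2
    box3 := m2.1
    box4 := m2.2
    low := fun h => ptwCl_low hD (g3 h)
    high := fun h => ptwCl_high hD (g4 h)
    ends := fun k1 k2 => by
      have k3 := ptwCl_inner hD k1 k2
      simp only [k3] at k1 k2 ⊢
      obtain ⟨f1, f2, f3⟩ := g2 k1 k2
      rw [f1] at k1 k2 ⊢
      simp only [neg_zero, max_self, mul_zero, sub_zero] at k1 k2 ⊢
      rw [ptwCl_id (by linarith) (by linarith)]
      refine ⟨?_, by linarith, g7 f1 (by linarith)⟩
      ext
      · exact f1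
      · simp
      · simp
    bnd := g5
    lt2 := fun h => g6 h
    ent := fun t h1 h2 => ((ptwE_neg _ _ _).mp (e4 t h1 h2)).2.1 }

theorem ptw_fix {δ B : ℝ} (hδ : 0 < δ) (hB : 0 < B) (Φ1 Φ2 : ℝ × ℝ → ℝ × ℝ) (h1 : Continuous Φ1)
    (h2 : Continuous Φ2)
    (b1 : ∀ p : ℝ × ℝ, -(3 / 2 * δ) ≤ p.1 → p.1 ≤ 3 / 2 * δ → 0 ≤ p.2 → p.2 ≤ B →
      -(3 / 2 * δ) ≤ (Φ1 p).1 ∧ (Φ1 p).1 ≤ 3 / 2 * δ ∧ 0 ≤ (Φ1 p).2 ∧ (Φ1 p).2 ≤ B ∧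
      (p.1 ≤ -δ → (Φ1 p).1 = -(3 / 2 * δ)) ∧ (δ ≤ p.1 → (Φ1 p).1 = 3 / 2 * δ))
    (b2 : ∀ p : ℝ × ℝ, -(3 / 2 * δ) ≤ p.1 → p.1 ≤ 3 / 2 * δ → 0 ≤ p.2 → p.2 ≤ B →
      -(3 / 2 * δ) ≤ (Φ2 p).1 ∧ (Φ2 p).1 ≤ 3 / 2 * δ ∧ 0 ≤ (Φ2 p).2 ∧ (Φ2 p).2 ≤ B ∧
      (p.1 ≤ -δ → (Φ2 p).1 = -(3 / 2 * δ)) ∧ (δ ≤ p.1 → (Φ2 p).1 = 3 / 2 * δ)) :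
    ∃ p : ℝ × ℝ, -δ ≤ p.1 ∧ p.1 ≤ δ ∧ 0 ≤ p.2 ∧ p.2 ≤ B ∧ Φ2 (Φ1 p) = p := by
  have c : Continuous (fun p => Φ2 (Φ1 p)) := h2.comp h1
  have c1 : Continuous (fun p => (Φ2 (Φ1 p)).1) := continuous_fst.comp c
  have c2 : Continuous (fun p => (Φ2 (Φ1 p)).2) := continuous_snd.comp c
  obtain ⟨p, ⟨p1, p2⟩, ⟨p3, p4⟩, q1, q2⟩ := ptw_miranda (fun p => (Φ2 (Φ1 p)).1 - p.1)
    (fun p => p.2 - (Φ2 (Φ1 p)).2) (c1.sub continuous_fst) (continuous_snd.sub c2)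
    (-δ) δ 0 B (by linarith) hB
    (fun y hy => by
      have a1 := b1 (-δ, y) (by simp only; linarith) (by simp only; linarith) hy.1 hy.2
      have a2 := b2 (Φ1 (-δ, y)) a1.1 a1.2.1 a1.2.2.1 a1.2.2.2.1
      have a3 := a1.2.2.2.2.1 le_rfl
      have a4 := a2.2.2.2.2.1 (by linarith)
      simp only; linarith)
    (fun y hy => by
      have a1 := b1 (δ, y) (by simp only; linarith) (by simp only; linarith) hy.1 hy.2
      have a2 := b2 (Φ1 (δ, y)) a1.1 a1.2.1 a1.2.2.1 a1.2.2.2.1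
      have a3 := a1.2.2.2.2.2 le_rfl
      have a4 := a2.2.2.2.2.2 (by linarith)
      simp only; linarith)
    (fun x hx => by
      have a1 := b1 (x, 0) (by simp only; linarith [hx.1]) (by simp only; linarith [hx.2]) le_rfl hB.le
      have a2 := b2 (Φ1 (x, 0)) a1.1 a1.2.1 a1.2.2.1 a1.2.2.2.1
      simp only; linarith [a2.2.2.1])
    (fun x hx => by
      have a1 := b1 (x, B) (by simp only; linarith [hx.1]) (by simp only; linarith [hx.2]) hB.le le_rfl
      have a2 := b2 (Φ1 (x, B)) a1.1 a1.2.1 a1.2.2.1 a1.2.2.2.1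
      simp only; linarith [a2.2.2.2.1])
  exact ⟨p, p1, p2, p3, p4, Prod.ext (by linarith) (by linarith)⟩

theorem ptw_shift (V : ℝ × ℝ × ℝ → ℝ × ℝ × ℝ) (f : ℝ → ℝ × ℝ × ℝ) (s : ℝ)
    (h : ∀ t, HasDerivAt f (V (f t)) t) : ∀ t, HasDerivAt (fun t => f (t + s)) (V (f (t + s))) t :=
  fun t => (h (t + s)).comp_add_const t s

theorem ptw_full {c κ e δ β η Q γ : ℝ} (P : PPar c κ e δ β η Q γ) (b : ℝ)
    (hb : |b| + 2 * γ + 2 * e ≤ 1) :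
    ∃ (L : ℝ) (y q W : ℝ → ℝ), 0 < L ∧
      (∀ t, HasDerivAt y (-(q t)) t) ∧
      (∀ t, HasDerivAt q (-c * q t + (y t) ^ 2 * (3 - y t) - W t) t) ∧
      (∀ t, HasDerivAt W (κ * (1 + b + γ * (W t - 2) - y t)) t) ∧
      (∃ t1 t2, y t1 ≠ y t2) ∧
      (∀ t, y (t + L) = y t ∧ q (t + L) = q t ∧ W (t + L) = W t) ∧
      (∀ T, 0 < T → (∀ t, y (t + T) = y t ∧ q (t + T) = q t ∧ W (t + T) = W t) → L ≤ T) ∧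
      |δ ^ 3 * L - (ptwJ c b γ e (-1) + ptwJ c (-b) γ e (-1))| ≤ 2 * (ptwCp c e Q * δ) := by
  have hδ := P.hδ
  have he := P.he
  have he1 := P.he1
  have hκ : 0 < κ := by
    have h1 : 0 < κ * c := by rw [P.hκ]; positivity
    exact (pos_iff_pos_of_mul_pos h1).mpr P.hc
  have hed : 384 * δ ≤ e := by have := P.s2; nlinarith
  have hB : 0 < 2 * β * (1 + η) := by
    have := P.bar.hβ; have := P.bar.hη; positivity
  obtain ⟨K1, L1⟩ := ptwV_lip c κ e γ b P.hc hκ P.hγ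
  obtain ⟨K2, L2⟩ := ptwV_lip c κ e γ (-b) P.hc hκ P.hγ
  obtain ⟨φ, a0, a1, a2, a3⟩ := ptw_flow _ K1 L1
  obtain ⟨ψ, b0, b1, b2, _⟩ := ptw_flow _ K2 L2
  obtain ⟨T1, Φ1, c1, H1⟩ := ptw_half P b hb φ a0 a1 a2
  obtain ⟨T2, Φ2, c2, H2⟩ := ptw_half P (-b) (by rwa [abs_neg]) ψ b0 b1 b2
  obtain ⟨p, p1, p2, p3, p4, hfix⟩ := ptw_fix hδ hB Φ1 Φ2 c1 c2
    (fun p x1 x2 x3 x4 => by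
      have := H1 p x1 x2 x3 x4
      exact ⟨this.box1, this.box2, this.box3, this.box4, this.low, this.high⟩)
    (fun p x1 x2 x3 x4 => by
      have := H2 p x1 x2 x3 x4
      exact ⟨this.box1, this.box2, this.box3, this.box4, this.low, this.high⟩)
  have h1 := H1 p (by linarith) (by linarith) p3 p4
  have h2 := H2 (Φ1 p) h1.box1 h1.box2 h1.box3 h1.box4
  rw [hfix] at h2
  obtain ⟨e2, pos2, per2⟩ := h2.ends (by linarith) (by linarith)
  have hlo : -δ < (Φ1 p).1 := by
    by_contra h
    have := h2.low (by linarith)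
    linarith
  have hhi : (Φ1 p).1 < δ := by
    by_contra h
    have := h2.high (by linarith)
    linarith
  obtain ⟨e1, pos1, per1⟩ := h1.ends (by linarith) (by linarith)
  generalize Φ1 p = p' at *
  generalize T1 p = t1 at *
  generalize T2 p' = t2 at *
  obtain ⟨X, hX⟩ : ∃ X, X = φ (2, p.2, p.1) := ⟨_, rfl⟩
  obtain ⟨Y, hY⟩ : ∃ Y, Y = ψ (2, p'.2, p'.1) := ⟨_, rfl⟩
  have hX0 : X 0 = (2, p.2, p.1) := by rw [hX, a0]
  have hY0 : Y 0 = (2, p'.2, p'.1) := by rw [hY, b0]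
  have hXd : ∀ t, HasDerivAt X (ptwV c κ e γ b (X t)) t := by rw [hX]; exact a1 _
  have hYd : ∀ t, HasDerivAt Y (ptwV c κ e γ (-b) (Y t)) t := by rw [hY]; exact b1 _
  rw [← hX] at h1 e1
  rw [← hY] at h2 e2
  have T0 := h1.T0
  have T0' := h2.T0
  have hglue : ∀ t, X (t + t1) = ptwS (Y t) := by
    have k1 := a3 (fun t => X (t + t1)) (ptw_shift _ X t1 hXd)
    have k2 := a3 (fun t => ptwS (Y t)) (fun t => ptwS_der c κ e γ b he Y t (hYd t))
    have k3 : X (0 + t1) = ptwS (Y 0) := by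
      rw [zero_add, e1, hY0, ptwS]; norm_num
    rw [k3] at k1
    intro t
    have := congrFun (k1.trans k2.symm) t
    exact this
  have hper : ∀ t, X (t + (t1 + t2)) = X t := by
    have k1 := a3 (fun t => X (t + (t1 + t2))) (ptw_shift _ X (t1 + t2) hXd)
    have k2 := a3 X hXd
    have k3 : X (0 + (t1 + t2)) = X 0 := by
      have : (0:ℝ) + (t1 + t2) = t2 + t1 := by ring
      rw [this, hglue, e2, hX0, ptwS]; norm_num
    rw [k3] at k1
    intro t
    exact congrFun (k1.trans k2.symm) t
  have hbnd : ∀ t, -3 ≤ (X t).1 ∧ (X t).1 ≤ 5 ∧ -(2 * δ) ≤ (X t).2.2 ∧ (X t).2.2 ≤ 4 + 2 * δ := by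
    intro t
    have hp : Function.Periodic X (t1 + t2) := hper
    obtain ⟨s, ⟨hs0, hs1⟩, hs⟩ := hp.exists_mem_Ico₀ (by linarith) t
    rw [hs]
    rcases le_total s t1 with g | g
    · have := h1.bnd s hs0 g
      exact ⟨by linarith, by linarith, this.2.2.1, this.2.2.2⟩
    · have := h2.bnd (s - t1) (by linarith) (by linarith)
      have k := hglue (s - t1)
      rw [sub_add_cancel] at k
      rw [k, ptwS]
      simp only
      refine ⟨by linarith, by linarith, by linarith, by linarith⟩
  refine ⟨t1 + t2, fun t => (X t).1, fun t => (X t).2.1, fun t => (X t).2.2, by linarith,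
    fun t => (hXd t).fst, fun t => ?_, fun t => ?_, ⟨0, t1, ?_⟩, fun t => ?_, ?_, ?_⟩
  · have : HasDerivAt (fun t => (X t).2.1) (ptwV c κ e γ b (X t)).2.1 t := (hXd t).snd.fst
    refine this.congr_deriv ?_
    simp only [ptwV]
    rw [ptwCl_id (hbnd t).1 (hbnd t).2.1]
  · have : HasDerivAt (fun t => (X t).2.2) (ptwV c κ e γ b (X t)).2.2 t := (hXd t).snd.snd
    refine this.congr_deriv ?_
    have := hbnd t
    simp only [ptwV]
    rw [ptwCl_id (by linarith) (by linarith)]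
  · simp only
    rw [hX0, e1]; norm_num
  · simp only
    rw [hper]; simp
  · intro T hT hall
    by_contra hlt
    push Not at hlt
    have k := hall 0
    simp only [zero_add] at k
    rw [hX0] at k
    simp only at k
    rcases le_or_gt T t1 with g | g
    · have := h1.lt2 pos2 T hT g
      linarith [k.1]
    · have m := h2.ent (T - t1) (by linarith) (by linarith)
      have n := hglue (T - t1)
      rw [sub_add_cancel] at n
      rw [n, ptwS] at k
      simp only at k
      rcases m with m | m
      · linarith [k.1]
      · linarith [k.2.2]
  · have e5 : δ ^ 3 * (t1 + t2) - (ptwJ c b γ e (-1) + ptwJ c (-b) γ e (-1)) =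
      (δ ^ 3 * t1 - ptwJ c b γ e (-1)) + (δ ^ 3 * t2 - ptwJ c (-b) γ e (-1)) := by ring
    rw [e5]
    exact (abs_add_le _ _).trans (by linarith)

theorem ptw_ev (A B : ℝ) (hB : 0 < B) : ∀ᶠ δ in nhdsWithin (0:ℝ) (Set.Ioi 0), A * δ < B := by
  have h : Filter.Tendsto (fun δ : ℝ => A * δ) (nhds 0) (nhds (A * 0)) :=
    (continuous_const.mul continuous_id).tendsto 0
  rw [mul_zero] at h
  exact (h.mono_left nhdsWithin_le_nhds).eventually_lt_const hB

theorem ptw_small (c e β η Q γ : ℝ) (hc : 0 < c) (he : 0 < e) (he1 : e < 1) (hβ : 0 < β)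
    (hβ2 : 2 * β ^ 2 = 1) (hη : 0 < η) (hm : β * (3 + 2 * η) < c) (hQ1 : 2 * β * (1 + η) ≤ Q)
    (hQ2 : 21 ≤ c * Q) (hγ : 0 < γ) :
    ∃ δ0 > 0, ∀ δ, 0 < δ → δ < δ0 → PPar c (δ ^ 3 / c) e δ β η Q γ := by
  have hTc : 0 < ptwTc c e := by unfold ptwTc; positivity
  have h := (ptw_ev 6 (c ^ 2) (by positivity)).and <| (ptw_ev 384 (e ^ 2) (by positivity)).and <|
    (ptw_ev 24 (e * c ^ 2) (by positivity)).and <| (ptw_ev 2 η hη).and <| (ptw_ev 1 1 one_pos).and <|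
    (ptw_ev (10 * ptwTc c e / c) 1 one_pos).and <| (ptw_ev (10 / c ^ 2 + 160) 1 one_pos).and
    (ptw_ev (10 * Q / c) 1 one_pos)
  obtain ⟨δ0, h0, hs⟩ := mem_nhdsGT_iff_exists_Ioo_subset.mp h
  refine ⟨δ0, h0, fun δ hδ hδ0 => ?_⟩
  obtain ⟨k1, k2, k3, k4, k5, k6, k7, k8⟩ := hs ⟨hδ, hδ0⟩
  have hδ1 : δ ^ 2 ≤ δ := by nlinarith
  exact {
    hc := hc
    hκ := by field_simp
    he := he
    he1 := he1
    hδ := hδ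
    s1 := k1.le
    s2 := k2.le
    s3 := k3.le
    s4 := by
      have e1 : 10 * (δ ^ 3 / c) * ptwTc c e = (10 * ptwTc c e / c * δ) * δ ^ 2 := by ring
      rw [e1]
      have h1 : (10 * ptwTc c e / c * δ) * δ ^ 2 < 1 * δ ^ 2 := by gcongr
      linarith
    bar := ⟨hβ, hβ2, hη, hm, k4.le⟩
    hQ1 := hQ1
    hQ2 := hQ2
    s5 := by
      have e1 : 10 * (δ ^ 3 / c) * (1 / c + 16 * c / δ) = (10 / c ^ 2 * δ ^ 2 + 160 * δ) * δ := by
        field_simp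
        ring
      rw [e1]
      have h2 : 10 / c ^ 2 * δ ^ 2 ≤ 10 / c ^ 2 * δ := by gcongr
      have h1 : (10 / c ^ 2 * δ ^ 2 + 160 * δ) * δ < 1 * δ := by
        apply mul_lt_mul_of_pos_right _ hδ
        linarith
      linarith
    s6 := by
      have e1 : 10 * (δ ^ 3 / c) * Q = (10 * Q / c * δ) * δ ^ 2 := by ring
      rw [e1]
      have h1 : (10 * Q / c * δ) * δ ^ 2 < 1 * δ ^ 2 := by gcongr
      linarith
    hγ := hγ }

theorem ptw_norm (c β γ b : ℝ) (hβ : 0 < β) (hβ2 : 2 * β ^ 2 = 1) (hc : 3 * β < c) (hγ : 0 < γ)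
    (hb : |b| + 2 * γ < 1) :
    ∃ e δ0 C : ℝ, 0 < e ∧ |b| + 2 * γ + 2 * e ≤ 1 ∧ 0 < δ0 ∧ ∀ δ, 0 < δ → δ < δ0 →
    ∃ (L : ℝ) (y q W : ℝ → ℝ), 0 < L ∧
      (∀ t, HasDerivAt y (-(q t)) t) ∧
      (∀ t, HasDerivAt q (-c * q t + (y t) ^ 2 * (3 - y t) - W t) t) ∧
      (∀ t, HasDerivAt W (δ ^ 3 / c * (1 + b + γ * (W t - 2) - y t)) t) ∧
      (∃ t1 t2, y t1 ≠ y t2) ∧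
      (∀ t, y (t + L) = y t ∧ q (t + L) = q t ∧ W (t + L) = W t) ∧
      (∀ T, 0 < T → (∀ t, y (t + T) = y t ∧ q (t + T) = q t ∧ W (t + T) = W t) → L ≤ T) ∧
      |δ ^ 3 * L - (ptwJ c b γ e (-1) + ptwJ c (-b) γ e (-1))| ≤ C * δ := by
  have hc0 : 0 < c := by linarith
  have hb0 := abs_nonneg b
  obtain ⟨e, hed⟩ : ∃ e, e = (1 - 2 * γ - |b|) / 2 := ⟨_, rfl⟩
  obtain ⟨η, hη⟩ : ∃ η, η = (c / β - 3) / 4 := ⟨_, rfl⟩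
  have h3 : 3 < c / β := by rw [lt_div_iff₀ hβ]; exact hc
  have hη0 : 0 < η := by rw [hη]; linarith
  have hm : β * (3 + 2 * η) < c := by
    have : β * (c / β) = c := by field_simp
    have h4 : β * (3 + 2 * η) < β * (c / β) := by
      apply mul_lt_mul_of_pos_left _ hβ; rw [hη]; linarith
    linarith
  obtain ⟨δ0, h0, hs⟩ := ptw_small c e β η (max (2 * β * (1 + η)) (21 / c)) γ hc0 (by linarith)
    (by linarith) hβ hβ2 hη0 hm (le_max_left _ _) (by
      have h5 := mul_le_mul_of_nonneg_left (le_max_right (2 * β * (1 + η)) (21 / c)) hc0.le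
      have h6 : c * (21 / c) = 21 := by field_simp
      linarith) hγ
  refine ⟨e, δ0, 2 * ptwCp c e (max (2 * β * (1 + η)) (21 / c)), by linarith, by linarith, h0,
    fun δ k1 k2 => ?_⟩
  have := ptw_full (hs δ k1 k2) b (by linarith)
  rw [← mul_assoc] at this
  exact this

theorem ptwDen_eq (b γ e x : ℝ) (hγ : 0 < γ) (he : 0 < e) (hb : |b| + 2 * γ + 2 * e ≤ 1) (_h1 : -1 ≤ x) (h2 : x ≤ 0) :
    ptwDen b γ e x = 1 + b + γ * (x ^ 2 * (3 - x) - 2) - x ∧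
      e ≤ 1 + b + γ * (x ^ 2 * (3 - x) - 2) - x := by
  have h1 : 0 ≤ γ * (x ^ 2 * (3 - x)) := by
    apply mul_nonneg hγ.le; apply mul_nonneg (sq_nonneg _); linarith
  have := neg_abs_le b
  have k : e ≤ 1 + b + γ * (x ^ 2 * (3 - x) - 2) - x := by linarith
  exact ⟨max_eq_right k, k⟩

theorem ptw_fd (a u : ℝ) : deriv (fcube a) u = -3 * u ^ 2 + 2 * (1 + a) * u - a := by
  have h : HasDerivAt (fcube a) ((1 * (u - a) + u * 1) * (1 - u) + u * (u - a) * (-1)) u :=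
    ((hasDerivAt_id u).mul ((hasDerivAt_id u).sub_const a)).mul ((hasDerivAt_id u).const_sub 1)
  rw [h.deriv]; ring

theorem ptw_f (a m z : ℝ) (hm : 9 * m ^ 2 = 1 - a + a ^ 2) :
    fcube a ((1 + a) / 3 + m * z) = fcube a ((1 + a) / 3) + m ^ 3 * (3 * z - z ^ 3) := by
  unfold fcube
  linear_combination (-(m * z) / 3) * hm

theorem ptw_f2 (a m z : ℝ) (hm : 9 * m ^ 2 = 1 - a + a ^ 2) :
    deriv (fcube a) ((1 + a) / 3 + m * z) = m ^ 2 * (3 - 3 * z ^ 2) := by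
  rw [ptw_fd]
  linear_combination (-1 / 3) * hm

theorem ptw_Ll (a γ c m e b : ℝ) (hm0 : 0 < m) (hm : 9 * m ^ 2 = 1 - a + a ^ 2) (hγ : 0 < γ) (he : 0 < e)
    (hbd : m * b = a - (1 + a) / 3 + γ * fcube a ((1 + a) / 3))
    (hb : |b| + 2 * (γ * m ^ 2) + 2 * e ≤ 1)
    (h1 : uOne a = (1 + a) / 3 - m) (h2 : uBarTwo a = (1 + a) / 3 - 2 * m) :
    Lleft a γ c = m ^ 3 * ptwJ (c / m) b (γ * m ^ 2) e (-1) := by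
  unfold Lleft ptwJ
  have e1 : uOne a = m * 0 + ((1 + a) / 3 - m) := by rw [h1]; ring
  have e2 : uBarTwo a = m * (-1) + ((1 + a) / 3 - m) := by rw [h2]; ring
  rw [e1, e2, ← intervalIntegral.mul_integral_comp_mul_add]
  have : m ^ 3 * ∫ s in (0:ℝ)..(-1), ptwg (c / m) b (γ * m ^ 2) e s =
      m * ∫ s in (0:ℝ)..(-1), m ^ 2 * ptwg (c / m) b (γ * m ^ 2) e s := by
    rw [intervalIntegral.integral_const_mul]; ring
  rw [this]
  congr 1
  apply intervalIntegral.integral_congr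
  intro x hx
  rw [Set.uIcc_of_ge (by norm_num)] at hx
  obtain ⟨d1, d2⟩ := ptwDen_eq b (γ * m ^ 2) e x (by positivity) he hb hx.1 hx.2
  have e3 : m * x + ((1 + a) / 3 - m) = (1 + a) / 3 + m * (x - 1) := by ring
  simp only
  rw [e3, ptw_f2 a m _ hm, ptw_f a m _ hm, ptwg, d1]
  have e4 : (1 + a) / 3 + m * (x - 1) - γ * (fcube a ((1 + a) / 3) + m ^ 3 * (3 * (x - 1) - (x - 1) ^ 3)) - a
      = -(m * (1 + b + γ * m ^ 2 * (x ^ 2 * (3 - x) - 2) - x)) := by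
    linear_combination hbd
  rw [e4]
  have hD : 1 + b + γ * m ^ 2 * (x ^ 2 * (3 - x) - 2) - x ≠ 0 := by linarith
  generalize 1 + b + γ * m ^ 2 * (x ^ 2 * (3 - x) - 2) - x = D at *
  field_simp
  ring

theorem ptw_Lr (a γ c m e b : ℝ) (hm0 : 0 < m) (hm : 9 * m ^ 2 = 1 - a + a ^ 2) (hγ : 0 < γ) (he : 0 < e)
    (hbd : m * b = a - (1 + a) / 3 + γ * fcube a ((1 + a) / 3))
    (hb : |b| + 2 * (γ * m ^ 2) + 2 * e ≤ 1)
    (h1 : uBarOne a = (1 + a) / 3 + m) (h2 : uTwo a = (1 + a) / 3 + 2 * m) :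
    Lright a γ c = m ^ 3 * ptwJ (c / m) (-b) (γ * m ^ 2) e (-1) := by
  unfold Lright ptwJ
  have e1 : uBarOne a = (-m) * 0 + ((1 + a) / 3 + m) := by rw [h1]; ring
  have e2 : uTwo a = (-m) * (-1) + ((1 + a) / 3 + m) := by rw [h2]; ring
  rw [e1, e2, ← intervalIntegral.mul_integral_comp_mul_add]
  have : m ^ 3 * ∫ s in (0:ℝ)..(-1), ptwg (c / m) (-b) (γ * m ^ 2) e s =
      (-m) * ∫ s in (0:ℝ)..(-1), (-m ^ 2) * ptwg (c / m) (-b) (γ * m ^ 2) e s := by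
    rw [intervalIntegral.integral_const_mul]; ring
  rw [this]
  congr 1
  apply intervalIntegral.integral_congr
  intro x hx
  rw [Set.uIcc_of_ge (by norm_num)] at hx
  obtain ⟨d1, d2⟩ := ptwDen_eq (-b) (γ * m ^ 2) e x (by positivity) he (by rwa [abs_neg]) hx.1 hx.2
  have e3 : -m * x + ((1 + a) / 3 + m) = (1 + a) / 3 + m * (1 - x) := by ring
  simp only
  rw [e3, ptw_f2 a m _ hm, ptw_f a m _ hm, ptwg, d1]
  have e4 : (1 + a) / 3 + m * (1 - x) - γ * (fcube a ((1 + a) / 3) + m ^ 3 * (3 * (1 - x) - (1 - x) ^ 3)) - a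
      = m * (1 + -b + γ * m ^ 2 * (x ^ 2 * (3 - x) - 2) - x) := by
    linear_combination hbd
  rw [e4]
  have hD : 1 + -b + γ * m ^ 2 * (x ^ 2 * (3 - x) - 2) - x ≠ 0 := by linarith
  generalize 1 + -b + γ * m ^ 2 * (x ^ 2 * (3 - x) - 2) - x = D at *
  field_simp
  ring

theorem ptw_bcond (a γ s : ℝ) (ha0 : 0 < a) (ha : a < 1 / 2) (hγ0 : 0 < γ) (hs : 0 < s)
    (hs2 : s ^ 2 = 1 - a + a ^ 2)
    (hγ : γ * (1 + 2 * a - 2 * a ^ 2 + (1 - 2 * a) * s) < 9) :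
    |(a - (1 + a) / 3 + γ * fcube a ((1 + a) / 3)) / (s / 3)| + 2 * (γ * (s / 3) ^ 2) < 1 := by
  obtain ⟨m, hmd⟩ : ∃ m, m = s / 3 := ⟨_, rfl⟩
  have hsm : s = 3 * m := by rw [hmd]; ring
  rw [← hmd]
  have hm0 : 0 < m := by rw [hmd]; positivity
  rw [hsm] at hγ hs2
  have hm : 9 * m ^ 2 = 1 - a + a ^ 2 := by linarith
  have f1 := ptw_f a m 1 hm
  have f2 := ptw_f a m (-1) hm
  have u1 : 0 < (1 + a) / 3 + m - a := by linarith
  have u2 : (1 + a) / 3 - m - a < 0 := by nlinarith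
  have g1 : γ * (((1 + a) / 3 + m) * (1 - ((1 + a) / 3 + m))) < 1 := by
    have : ((1 + a) / 3 + m) * (1 - ((1 + a) / 3 + m)) = (1 + 2 * a - 2 * a ^ 2 + (1 - 2 * a) * (3 * m)) / 9 := by
      linear_combination (-1 / 9) * hm
    rw [this]; linarith
  have g2 : γ * (((1 + a) / 3 - m) * (1 - ((1 + a) / 3 - m))) < 1 := by
    have : ((1 + a) / 3 - m) * (1 - ((1 + a) / 3 - m)) = (1 + 2 * a - 2 * a ^ 2 - (1 - 2 * a) * (3 * m)) / 9 := by
      linear_combination (-1 / 9) * hm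
    rw [this]
    have : 0 < γ * ((1 - 2 * a) * (3 * m)) := by
      apply mul_pos hγ0; apply mul_pos <;> linarith
    linarith
  have k1 := mul_pos u1 (sub_pos.mpr g1)
  have k2 := mul_pos (neg_pos.mpr u2) (sub_pos.mpr g2)
  have e1 : γ * fcube a ((1 + a) / 3 + m * 1) = γ * (((1 + a) / 3 + m) * (1 - ((1 + a) / 3 + m))) * ((1 + a) / 3 + m - a) := by
    unfold fcube; ring
  have e2 : γ * fcube a ((1 + a) / 3 + m * (-1)) = γ * (((1 + a) / 3 - m) * (1 - ((1 + a) / 3 - m))) * ((1 + a) / 3 - m - a) := by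
    unfold fcube; ring
  rw [f1] at e1
  rw [f2] at e2
  have key : |a - (1 + a) / 3 + γ * fcube a ((1 + a) / 3)| < m - 2 * γ * m ^ 3 := by
    rw [abs_lt]; constructor <;> linarith
  rw [abs_div, abs_of_pos hm0]
  have e3 : |a - (1 + a) / 3 + γ * fcube a ((1 + a) / 3)| / m < 1 - 2 * (γ * m ^ 2) := by
    rw [div_lt_iff₀ hm0]; linarith
  linarith

/-- existence of phase-wave trains: for all small `ε > 0`, the traveling-wave
system admits a nonconstant periodic solution of minimal period `L_ε` satisfying
`|ε L_ε − (L_l + L_r)| ≤ C ε^{1/3}`. -/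
theorem stmt14 (a γ c : ℝ) (ha0 : 0 < a) (ha : a < 1 / 2)
    (hγ0 : 0 < γ) (hγ : γ < gammaStar a) (hc : cStar a < c) :
    ∃ ε₀ C : ℝ, 0 < ε₀ ∧ 1 ≤ C ∧
      ∀ ε : ℝ, 0 < ε → ε < ε₀ →
        ∃ (L : ℝ) (u v w : ℝ → ℝ), 0 < L ∧
          (∀ ξ : ℝ, HasDerivAt u (v ξ) ξ) ∧
          (∀ ξ : ℝ, HasDerivAt v (-c * v ξ - fcube a (u ξ) + w ξ) ξ) ∧
          (∀ ξ : ℝ, HasDerivAt w (-(ε / c) * (u ξ - γ * w ξ - a)) ξ) ∧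
          (∃ ξ₁ ξ₂ : ℝ, (u ξ₁, v ξ₁, w ξ₁) ≠ (u ξ₂, v ξ₂, w ξ₂)) ∧
          (∀ ξ : ℝ, u (ξ + L) = u ξ ∧ v (ξ + L) = v ξ ∧ w (ξ + L) = w ξ) ∧
          (∀ T : ℝ, 0 < T →
            (∀ ξ : ℝ, u (ξ + T) = u ξ ∧ v (ξ + T) = v ξ ∧ w (ξ + T) = w ξ) → L ≤ T) ∧
          |ε * L - (Lleft a γ c + Lright a γ c)| ≤ C * ε ^ ((1 : ℝ) / 3) := by
  obtain ⟨s, hsd⟩ : ∃ s, s = Real.sqrt (1 - a + a ^ 2) := ⟨_, rfl⟩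
  have hpos : 0 < 1 - a + a ^ 2 := by nlinarith
  have hs : 0 < s := hsd ▸ Real.sqrt_pos.mpr hpos
  have hs2 : s ^ 2 = 1 - a + a ^ 2 := by rw [hsd, Real.sq_sqrt hpos.le]
  have hs' : Real.sqrt (a ^ 2 - a + 1) = s := by rw [hsd]; congr 1; ring
  have hγ' : γ * (1 + 2 * a - 2 * a ^ 2 + (1 - 2 * a) * s) < 9 := by
    unfold gammaStar at hγ
    rw [hs'] at hγ
    have hp : 0 < 1 + 2 * a - 2 * a ^ 2 + (1 - 2 * a) * s := by
      have : 0 < (1 - 2 * a) * s := mul_pos (by linarith) hs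
      nlinarith
    rwa [lt_div_iff₀ hp] at hγ
  have hbc := ptw_bcond a γ s ha0 ha hγ0 hs hs2 hγ'
  obtain ⟨m, hmd⟩ : ∃ m, m = s / 3 := ⟨_, rfl⟩
  have hsm : s = 3 * m := by rw [hmd]; ring
  have hm0 : 0 < m := by rw [hmd]; positivity
  have hm : 9 * m ^ 2 = 1 - a + a ^ 2 := by rw [← hs2, hsm]; ring
  rw [← hmd] at hbc
  obtain ⟨b, hbd⟩ : ∃ b, b = (a - (1 + a) / 3 + γ * fcube a ((1 + a) / 3)) / m := ⟨_, rfl⟩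
  rw [← hbd] at hbc
  have hbd' : m * b = a - (1 + a) / 3 + γ * fcube a ((1 + a) / 3) := by rw [hbd]; field_simp
  obtain ⟨β, hβd⟩ : ∃ β, β = Real.sqrt (1 / 2) := ⟨_, rfl⟩
  have hβ : 0 < β := hβd ▸ Real.sqrt_pos.mpr (by norm_num)
  have hβ2 : 2 * β ^ 2 = 1 := by rw [hβd, Real.sq_sqrt (by norm_num)]; norm_num
  have hcs : cStar a = s * β := by
    unfold cStar
    rw [hsd, hβd, ← Real.sqrt_mul hpos.le]; congr 1; ring
  have hc0 : 0 < c := lt_trans (by rw [hcs]; positivity) hc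
  have hc' : 3 * β < c / m := by
    rw [lt_div_iff₀ hm0]
    rw [hcs, hsm] at hc
    linarith
  obtain ⟨e, δ0, C, he, hbe, hδ0, hmain⟩ := ptw_norm (c / m) β (γ * m ^ 2) b hβ hβ2 hc' (by positivity) hbc
  have hLl := ptw_Ll a γ c m e b hm0 hm hγ0 he hbd' hbe
    (by unfold uOne; rw [← hsd, hsm]; ring) (by unfold uBarTwo; rw [← hsd, hsm]; ring)
  have hLr := ptw_Lr a γ c m e b hm0 hm hγ0 he hbd' hbe
    (by unfold uBarOne; rw [← hsd, hsm]; ring) (by unfold uTwo; rw [← hsd, hsm]; ring)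
  refine ⟨m ^ 4 * δ0 ^ 3, max 1 (m ^ 3 * C / (m ^ 4) ^ ((1:ℝ) / 3)), by positivity, le_max_left _ _, ?_⟩
  intro ε hε hε0
  obtain ⟨δ, hδd⟩ : ∃ δ, δ = (ε / m ^ 4) ^ ((1:ℝ) / 3) := ⟨_, rfl⟩
  have hδ : 0 < δ := by rw [hδd]; positivity
  have hδ3 : δ ^ 3 = ε / m ^ 4 := by
    rw [hδd, ← Real.rpow_natCast, ← Real.rpow_mul (by positivity)]
    norm_num
  have hε' : ε = m ^ 4 * δ ^ 3 := by rw [hδ3]; field_simp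
  have hδlt : δ < δ0 := by
    rw [hε'] at hε0
    have : δ ^ 3 < δ0 ^ 3 := lt_of_mul_lt_mul_left hε0 (by positivity)
    exact lt_of_pow_lt_pow_left₀ 3 hδ0.le this
  obtain ⟨L, y, q, W, hL, hy, hq, hW, ⟨t1, t2, hne⟩, hper, hmin, herr⟩ := hmain δ hδ hδlt
  have hin : ∀ ξ : ℝ, HasDerivAt (fun ξ : ℝ => m * ξ) m ξ := fun ξ => by
    simpa using (hasDerivAt_id ξ).const_mul m
  have hmL : m * (L / m) = L := by field_simp
  refine ⟨L / m, fun ξ => (1 + a) / 3 + m * (y (m * ξ) - 1), fun ξ => -(m ^ 2 * q (m * ξ)),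
    fun ξ => fcube a ((1 + a) / 3) + m ^ 3 * (W (m * ξ) - 2), by positivity, ?_, ?_, ?_, ?_, ?_, ?_, ?_⟩
  · intro ξ
    have h1 : HasDerivAt (fun ξ => y (m * ξ)) (-(q (m * ξ)) * m) ξ := (hy (m * ξ)).comp ξ (hin ξ)
    exact (((h1.sub_const 1).const_mul m).const_add _).congr_deriv (by ring)
  · intro ξ
    have h1 : HasDerivAt (fun ξ => q (m * ξ)) _ ξ := (hq (m * ξ)).comp ξ (hin ξ)
    refine ((h1.const_mul (m ^ 2)).neg).congr_deriv ?_
    rw [ptw_f a m _ hm]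
    field_simp
    ring
  · intro ξ
    have h1 : HasDerivAt (fun ξ => W (m * ξ)) _ ξ := (hW (m * ξ)).comp ξ (hin ξ)
    refine (((h1.sub_const 2).const_mul (m ^ 3)).const_add _).congr_deriv ?_
    rw [hε']
    field_simp
    linear_combination 3 * hbd'
  · refine ⟨t1 / m, t2 / m, fun h => hne ?_⟩
    have h1 := congrArg Prod.fst h
    simp only at h1
    have e1 : m * (t1 / m) = t1 := by field_simp
    have e2 : m * (t2 / m) = t2 := by field_simp
    rw [e1, e2] at h1
    have h2 : m * (y t1 - 1) = m * (y t2 - 1) := by linarith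
    linarith [mul_left_cancel₀ hm0.ne' h2]
  · intro ξ
    have := hper (m * ξ)
    simp only [mul_add, hmL]
    rw [this.1, this.2.1, this.2.2]
    simp
  · intro T hT hall
    have := hmin (m * T) (by positivity) (fun t => by
      have k := hall (t / m)
      have e1 : m * (t / m) = t := by field_simp
      simp only [mul_add, e1] at k
      obtain ⟨k1, k2, k3⟩ := k
      have m2 : m ^ 2 ≠ 0 := by positivity
      have m3 : m ^ 3 ≠ 0 := by positivity
      refine ⟨mul_left_cancel₀ hm0.ne' (by linarith), mul_left_cancel₀ m2 (by linarith),
        mul_left_cancel₀ m3 (by linarith)⟩)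
    rw [div_le_iff₀ hm0]; linarith
  · have e1 : ε * (L / m) - (Lleft a γ c + Lright a γ c) = m ^ 3 *
        (δ ^ 3 * L - (ptwJ (c / m) b (γ * m ^ 2) e (-1) + ptwJ (c / m) (-b) (γ * m ^ 2) e (-1))) := by
      rw [hLl, hLr, hε']; field_simp
    rw [e1, abs_mul, abs_of_pos (by positivity : 0 < m ^ 3)]
    have e2 : δ = ε ^ ((1:ℝ) / 3) / (m ^ 4) ^ ((1:ℝ) / 3) := by
      rw [hδd, Real.div_rpow hε.le (by positivity)]
    calc m ^ 3 * _ ≤ m ^ 3 * (C * δ) := by gcongr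
      _ = m ^ 3 * C / (m ^ 4) ^ ((1:ℝ) / 3) * ε ^ ((1:ℝ) / 3) := by rw [e2]; ring
      _ ≤ _ := by
        gcongr
        exact le_max_right _ _
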